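/- For given Hermite data consisting of all partial derivatives up to order 2 at the three vertices of Δ (18 values), first normal derivatives at the three edge midpoints and second normal derivatives at the six edge trisection points (9 values), and the value at the barycenter (1 value), there exists a unique spline s ∈ S₃²(Δ_{WS₃}) matching these data. -/

import Mathlib

open MeasureTheory

/-- The plane `ℝ²` as a Euclidean space. -/
abbrev V2 := EuclideanSpace ℝ (Fin 2)

/-- The (closed) triangle with vertices `p 0, p 1, p 2`. -/
def tri (p : Fin 3 → V2) : Set V2 := convexHull ℝ (Set.range p)

/-- The `3·3 = 9` boundary points of the WS₃ split: the vertices together with the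
trisection points of the edges. -/
def wsPts (p : Fin 3 → V2) : Set V2 :=
  {x | ∃ i j : Fin 3, ∃ k : Fin 4,
    x = ((k : ℝ) / 3) • p i + (1 - (k : ℝ) / 3) • p j}

/-- The union of all the lines of the complete graph on the 9 boundary points of the
WS₃ split. -/
def cutLines (p : Fin 3 → V2) : Set V2 :=
  {x | ∃ a ∈ wsPts p, ∃ b ∈ wsPts p, a ≠ b ∧
    x ∈ (affineSpan ℝ ({a, b} : Set V2) : Set V2)}

/-- `g` is (the restriction of) a bivariate polynomial of total degree at most `d`. -/
def IsPolyDeg (d : ℕ) (g : V2 → ℝ) : Prop :=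
  ∃ q : MvPolynomial (Fin 2) ℝ, q.totalDegree ≤ d ∧
    ∀ z : V2, g z = MvPolynomial.eval (fun i => z i) q

/-- The spline space `S₃²(Δ_{WS₃})`: functions (extended by zero outside `Δ`) that are
`C²` on the triangle `Δ` and coincide with a cubic polynomial on every open region of
the WS₃ split (the connected components of the interior of `Δ` minus the complete
graph of lines through the 9 boundary points). -/
def splineSpace (p : Fin 3 → V2) : Set (V2 → ℝ) :=
  {f | ContDiffOn ℝ 2 f (tri p) ∧
    (∀ x ∈ interior (tri p) \ cutLines p,
      ∃ g, IsPolyDeg 3 g ∧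
        Set.EqOn f g (connectedComponentIn (interior (tri p) \ cutLines p) x)) ∧
    ∀ x ∉ tri p, f x = 0}

/-- The 28 relative scaling weights of the simplex spline basis on the WS₃ split. -/
noncomputable def wvec : Fin 28 → ℝ :=
  ![1/6, 1/6, 1/6, 1/3, 1/3, 1/3, 1/3, 1/3, 1/3, 1/2, 1/2, 1/2, 1/2, 1/2, 1/2,
    2/3, 2/3, 2/3, 5/6, 5/6, 5/6, 2/3, 2/3, 2/3, 2/3, 2/3, 2/3, 1]

/-- Barycentric coordinates (w.r.t. `Δ`) of the 28 domain points of the simplex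
spline basis (0-indexed; entry `i` corresponds to the paper's `ξ_{i+1}`). -/
noncomputable def bary : Fin 28 → Fin 3 → ℝ :=
  ![![1, 0, 0], ![0, 1, 0], ![0, 0, 1],
    ![8/9, 1/9, 0], ![8/9, 0, 1/9], ![0, 8/9, 1/9],
    ![1/9, 8/9, 0], ![1/9, 0, 8/9], ![0, 1/9, 8/9],
    ![2/3, 1/3, 0], ![2/3, 0, 1/3], ![0, 2/3, 1/3],
    ![1/3, 2/3, 0], ![1/3, 0, 2/3], ![0, 1/3, 2/3],
    ![7/9, 1/9, 1/9], ![1/9, 7/9, 1/9], ![1/9, 1/9, 7/9],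
    ![7/15, 7/15, 1/15], ![1/15, 7/15, 7/15], ![7/15, 1/15, 7/15],
    ![5/9, 1/3, 1/9], ![5/9, 1/9, 1/3], ![1/9, 5/9, 1/3],
    ![1/3, 5/9, 1/9], ![1/3, 1/9, 5/9], ![1/9, 1/3, 5/9],
    ![1/3, 1/3, 1/3]]

/-- The domain points of the simplex spline basis on the triangle `p`. -/
noncomputable def dpt (p : Fin 3 → V2) (i : Fin 28) : V2 :=
  ∑ k : Fin 3, bary i k • p k

/-- The sup-norm of a function over the triangle `p`. -/
noncomputable def supTri (p : Fin 3 → V2) (f : V2 → ℝ) : ℝ :=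
  sSup ((fun x => |f x|) '' tri p)

/-- The index of the vertex different from `k` and `l` (for `k ≠ l`). -/
def thirdIdx (k l : Fin 3) : Fin 3 := ⟨(3 - (k.val + l.val)) % 3, by omega⟩

/-- The edge trisection point `p_{k,l} = (2/3)·p l + (1/3)·p m`, `m` the third vertex
(0-indexed version of the paper's points (3.1)). -/
noncomputable def ptrisect (p : Fin 3 → V2) (k l : Fin 3) : V2 :=
  (2 / 3 : ℝ) • p l + (1 / 3 : ℝ) • p (thirdIdx k l)

/-- The midpoint `q_k` of the edge opposite vertex `p k`. -/
noncomputable def qmid (p : Fin 3 → V2) (k : Fin 3) : V2 :=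
  (1 / 2 : ℝ) • p (k + 1) + (1 / 2 : ℝ) • p (k + 2)

/-- The barycenter of the triangle. -/
noncomputable def bctr (p : Fin 3 → V2) : V2 :=
  (1 / 3 : ℝ) • p 0 + (1 / 3 : ℝ) • p 1 + (1 / 3 : ℝ) • p 2

/-- The standard basis vector `e_i` of `ℝ²`. -/
noncomputable def ee (i : Fin 2) : V2 := EuclideanSpace.single i 1

open scoped RealInnerProductSpace


open Filter Topology

/-! ### Truncated cubes -/

/-- The truncated cube. -/
noncomputable def tp (t : ℝ) : ℝ := (max t 0) ^ 3

lemma tp_of_nonneg {t : ℝ} (h : 0 ≤ t) : tp t = t ^ 3 := by simp [tp, h]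

lemma tp_of_nonpos {t : ℝ} (h : t ≤ 0) : tp t = 0 := by simp [tp, h]

lemma hasDerivAt_maxpow (n : ℕ) (t : ℝ) :
    HasDerivAt (fun t : ℝ => (max t 0) ^ (n + 2)) ((n + 2 : ℝ) * (max t 0) ^ (n + 1)) t := by
  rcases lt_trichotomy t 0 with h | h | h
  · have h1 : (fun t : ℝ => (max t 0) ^ (n + 2)) =ᶠ[𝓝 t] fun _ => 0 := by
      filter_upwards [eventually_lt_nhds h] with s hs
      simp [max_eq_right hs.le]
    have := (hasDerivAt_const t (0 : ℝ)).congr_of_eventuallyEq h1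
    simpa [max_eq_right h.le] using this
  · subst h
    rw [hasDerivAt_iff_isLittleO_nhds_zero]
    have h1 : (fun h : ℝ => h ^ (n + 2)) =o[𝓝 0] fun h : ℝ => h := by
      simpa using (Asymptotics.isLittleO_pow_pow (𝕜 := ℝ) (m := 1) (n := n + 2) (by omega))
    refine Asymptotics.IsBigO.trans_isLittleO ?_ h1
    refine Asymptotics.IsBigO.of_bound 1 (Eventually.of_forall fun s => ?_)
    simp only [zero_add, max_self]
    rcases le_total s 0 with hs | hs
    · simp [max_eq_right hs]
    · simp [max_eq_left hs]
  · have h1 : (fun t : ℝ => (max t 0) ^ (n + 2)) =ᶠ[𝓝 t] fun t => t ^ (n + 2) := by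
      filter_upwards [eventually_gt_nhds h] with s hs
      simp [max_eq_left hs.le]
    have := (hasDerivAt_pow (n + 2) t).congr_of_eventuallyEq h1
    simpa [max_eq_left h.le] using this

lemma hasDerivAt_tp (t : ℝ) : HasDerivAt tp (3 * (max t 0) ^ 2) t := by
  have := hasDerivAt_maxpow 1 t
  norm_num at this
  exact this

lemma hasDerivAt_tp' (t : ℝ) :
    HasDerivAt (fun t : ℝ => 3 * (max t 0) ^ 2) (6 * max t 0) t := by
  have := ((hasDerivAt_maxpow 0 t).const_mul 3).congr_deriv (g' := 6 * max t 0)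
    (by push_cast; ring)
  simpa using this

lemma contDiff_tp : ContDiff ℝ 2 tp := by
  have h1 : deriv tp = fun t : ℝ => 3 * (max t 0) ^ 2 := funext fun t => (hasDerivAt_tp t).deriv
  have h2 : deriv (fun t : ℝ => 3 * (max t 0) ^ 2) = fun t : ℝ => 6 * max t 0 :=
    funext fun t => (hasDerivAt_tp' t).deriv
  have e2 : (2 : WithTop ℕ∞) = 1 + 1 := by norm_num
  have e1 : (1 : WithTop ℕ∞) = 0 + 1 := by norm_num
  rw [e2, contDiff_succ_iff_deriv]
  refine ⟨fun t => (hasDerivAt_tp t).differentiableAt, by simp, ?_⟩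
  rw [h1, e1, contDiff_succ_iff_deriv]
  refine ⟨fun t => (hasDerivAt_tp' t).differentiableAt, by simp, ?_⟩
  rw [h2, contDiff_zero]
  fun_prop

/-! ### Affine functions -/

lemma aff_add (l : V2 →ᵃ[ℝ] ℝ) (x v : V2) : l (x + v) = l x + l.linear v := by
  have := l.map_vadd x v
  simp only [vadd_eq_add] at this
  rw [add_comm x v, this, add_comm]

lemma aff_cont (l : V2 →ᵃ[ℝ] ℝ) : Continuous l := l.continuous_of_finiteDimensional

lemma aff_eq (l : V2 →ᵃ[ℝ] ℝ) (z : V2) : l z = LinearMap.toContinuousLinearMap l.linear z + l 0 := by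
  have := aff_add l 0 z
  simp only [zero_add] at this
  simp [this, add_comm]

lemma aff_analytic (l : V2 →ᵃ[ℝ] ℝ) (x : V2) : AnalyticAt ℝ (fun z => l z) x := by
  have : (fun z => l z) = fun z => LinearMap.toContinuousLinearMap l.linear z + l 0 :=
    funext fun z => aff_eq l z
  rw [this]
  exact (ContinuousLinearMap.analyticAt _ x).add analyticAt_const

lemma tp_aff_analytic (l : V2 →ᵃ[ℝ] ℝ) (x : V2) (h : l x ≠ 0) :
    AnalyticAt ℝ (fun z => tp (l z)) x := by
  rcases lt_or_gt_of_ne h with h | h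
  · refine (analyticAt_const (v := (0 : ℝ))).congr ?_
    filter_upwards [(aff_cont l).continuousAt.eventually (eventually_lt_nhds h)] with z hz
    exact (tp_of_nonpos (le_of_lt hz)).symm
  · refine ((aff_analytic l x).pow 3).congr ?_
    filter_upwards [(aff_cont l).continuousAt.eventually (eventually_gt_nhds h)] with z hz
    exact (tp_of_nonneg (le_of_lt hz)).symm

/-- Coordinates adapted to a nonzero linear form. -/
lemma exists_coords (φ : V2 →ₗ[ℝ] ℝ) (hφ : φ ≠ 0) :
    ∃ e n : V2, e ≠ 0 ∧ φ e = 0 ∧ φ n = 1 ∧ ∀ v, ∃ s : ℝ, v = s • e + φ v • n := by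
  set a := φ (ee 0)
  set b := φ (ee 1)
  have hv : ∀ v : V2, v = v 0 • ee 0 + v 1 • ee 1 := by
    intro v
    ext i
    fin_cases i <;> simp [ee]
  have hφv : ∀ v : V2, φ v = v 0 * a + v 1 * b := by
    intro v
    conv_lhs => rw [hv v]
    simp [a, b]
  have hab : a ^ 2 + b ^ 2 ≠ 0 := by
    intro h
    apply hφ
    have ha : a = 0 := by nlinarith [sq_nonneg a, sq_nonneg b]
    have hb : b = 0 := by nlinarith [sq_nonneg a, sq_nonneg b]
    ext v
    simp [hφv, ha, hb]
  refine ⟨!₂[-b, a], !₂[a / (a ^ 2 + b ^ 2), b / (a ^ 2 + b ^ 2)], ?_, ?_, ?_, ?_⟩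
  · intro h
    apply hab
    have h0 := congrArg (fun v : V2 => v 0) h
    have h1 := congrArg (fun v : V2 => v 1) h
    simp at h0 h1
    simp [h0, h1]
  · rw [hφv]; simp; ring
  · rw [hφv]; simp; field_simp
  · intro v
    refine ⟨(-b * v 0 + a * v 1) / (a ^ 2 + b ^ 2), ?_⟩
    rw [hφv]
    ext i
    fin_cases i
    · simp; field_simp; ring
    · simp; field_simp; ring

/-! ### Cubic functions -/

/-- A bivariate cubic with given coefficients. -/
def cubEval (a : Fin 10 → ℝ) (s t : ℝ) : ℝ :=
  a 0 + a 1 * s + a 2 * t + a 3 * s ^ 2 + a 4 * (s * t) + a 5 * t ^ 2 + a 6 * s ^ 3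
    + a 7 * (s ^ 2 * t) + a 8 * (s * t ^ 2) + a 9 * t ^ 3

/-- Functions that are cubic in every system of affine coordinates. -/
def Cub (P : V2 → ℝ) : Prop :=
  ∀ x e n : V2, ∃ a : Fin 10 → ℝ, ∀ s t : ℝ, P (x + s • e + t • n) = cubEval a s t

lemma Cub.add {P Q : V2 → ℝ} (hP : Cub P) (hQ : Cub Q) : Cub (fun z => P z + Q z) := by
  intro x e n
  obtain ⟨a, ha⟩ := hP x e n
  obtain ⟨b, hb⟩ := hQ x e n
  refine ⟨a + b, fun s t => ?_⟩
  simp only [ha, hb, cubEval, Pi.add_apply]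
  ring

lemma Cub.smul {P : V2 → ℝ} (hP : Cub P) (c : ℝ) : Cub (fun z => c * P z) := by
  intro x e n
  obtain ⟨a, ha⟩ := hP x e n
  refine ⟨c • a, fun s t => ?_⟩
  simp only [ha, cubEval, Pi.smul_apply, smul_eq_mul]
  ring

lemma Cub.zero : Cub (fun _ => 0) := fun _ _ _ => ⟨0, fun s t => by simp [cubEval]⟩

lemma Cub.sum {κ : Type*} (S : Finset κ) (P : κ → V2 → ℝ) (h : ∀ i ∈ S, Cub (P i)) :
    Cub (fun z => ∑ i ∈ S, P i z) := by
  classical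
  induction S using Finset.induction_on with
  | empty => simpa using Cub.zero
  | insert a S ha ih =>
    simp only [Finset.sum_insert ha]
    exact (h a (by simp)).add (ih fun i hi => h i (by simp [hi]))

lemma Cub.aff3 (l m k : V2 →ᵃ[ℝ] ℝ) : Cub (fun z => l z * m z * k z) := by
  intro x e n
  refine ⟨![l x * m x * k x,
    l.linear e * m x * k x + l x * m.linear e * k x + l x * m x * k.linear e,
    l.linear n * m x * k x + l x * m.linear n * k x + l x * m x * k.linear n,
    l.linear e * m.linear e * k x + l.linear e * m x * k.linear e + l x * m.linear e * k.linear e,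
    l.linear e * m.linear n * k x + l.linear e * m x * k.linear n + l x * m.linear e * k.linear n
    + l.linear n * m.linear e * k x + l.linear n * m x * k.linear e + l x * m.linear n * k.linear e,
    l.linear n * m.linear n * k x + l.linear n * m x * k.linear n + l x * m.linear n * k.linear n,
    l.linear e * m.linear e * k.linear e,
    l.linear e * m.linear e * k.linear n + l.linear e * m.linear n * k.linear e
    + l.linear n * m.linear e * k.linear e,
    l.linear e * m.linear n * k.linear n + l.linear n * m.linear e * k.linear n
    + l.linear n * m.linear n * k.linear e,
    l.linear n * m.linear n * k.linear n], fun s t => ?_⟩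
  simp only [aff_add, map_smul, smul_eq_mul, cubEval]
  simp
  ring

lemma Cub.cube (l : V2 →ᵃ[ℝ] ℝ) : Cub (fun z => l z ^ 3) := by
  have : (fun z => l z ^ 3) = fun z => l z * l z * l z := by
    ext z; ring
  rw [this]
  exact Cub.aff3 l l l

/-- Coordinate projections as affine maps. -/
noncomputable def coordAff (i : Fin 2) : V2 →ᵃ[ℝ] ℝ :=
  (EuclideanSpace.proj i : V2 →L[ℝ] ℝ).toLinearMap.toAffineMap

@[simp] lemma coordAff_apply (i : Fin 2) (z : V2) : coordAff i z = z i := rfl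

lemma IsPolyDeg.cub {g : V2 → ℝ} (h : IsPolyDeg 3 g) : Cub g := by
  obtain ⟨q, hq, hg⟩ := h
  have : g = fun z => ∑ m ∈ q.support, q.coeff m * (z 0 ^ m 0 * z 1 ^ m 1) := by
    ext z
    rw [hg, MvPolynomial.eval_eq']
    simp [Fin.prod_univ_two]
  rw [this]
  refine Cub.sum _ _ fun m hm => Cub.smul ?_ _
  have hd : m 0 + m 1 ≤ 3 := by
    have := MvPolynomial.le_totalDegree hm
    rw [Finsupp.sum_fintype _ _ (by simp)] at this
    simp [Fin.sum_univ_two] at this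
    omega
  generalize m 0 = i at *
  generalize m 1 = j at *
  have X := coordAff 0
  have key : ∃ l m k : V2 →ᵃ[ℝ] ℝ, ∀ z : V2, z 0 ^ i * z 1 ^ j = l z * m z * k z := by
    have hi : i ≤ 3 := by omega
    have hj : j ≤ 3 := by omega
    let O : V2 →ᵃ[ℝ] ℝ := AffineMap.const ℝ V2 1
    interval_cases i <;> interval_cases j <;> try omega
    · exact ⟨O, O, O, fun z => by simp [O]⟩
    · exact ⟨O, O, coordAff 1, fun z => by simp [O]⟩
    · exact ⟨O, coordAff 1, coordAff 1, fun z => by simp [O]; ring⟩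
    · exact ⟨coordAff 1, coordAff 1, coordAff 1, fun z => by simp only [coordAff_apply]; ring⟩
    · exact ⟨O, O, coordAff 0, fun z => by simp [O]⟩
    · exact ⟨O, coordAff 0, coordAff 1, fun z => by simp [O]⟩
    · exact ⟨coordAff 0, coordAff 1, coordAff 1, fun z => by simp only [coordAff_apply]; ring⟩
    · exact ⟨O, coordAff 0, coordAff 0, fun z => by simp [O]; ring⟩
    · exact ⟨coordAff 0, coordAff 0, coordAff 1, fun z => by simp only [coordAff_apply]; ring⟩
    · exact ⟨coordAff 0, coordAff 0, coordAff 0, fun z => by simp only [coordAff_apply]; ring⟩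
  obtain ⟨l, m, k, h⟩ := key
  simp only [h]
  exact Cub.aff3 l m k

lemma Cub.analyticAt {P : V2 → ℝ} (hP : Cub P) (x : V2) : AnalyticAt ℝ P x := by
  obtain ⟨a, ha⟩ := hP 0 (ee 0) (ee 1)
  have : P = fun z => cubEval a (coordAff 0 z) (coordAff 1 z) := by
    ext z
    rw [coordAff_apply, coordAff_apply, ← ha]
    congr 1
    ext i
    fin_cases i <;> simp [ee]
  rw [this]
  have h0 := aff_analytic (coordAff 0) x
  have h1 := aff_analytic (coordAff 1) x
  unfold cubEval
  fun_prop

/-! ### Uniqueness of the coefficients and passage from local to global -/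

section arrangement

variable {ι : Type*} [Fintype ι]

lemma coeff_unique (l : ι → V2 →ᵃ[ℝ] ℝ) (hne : ∀ i, (l i).linear ≠ 0)
    (hH : ∀ i j, i ≠ j → ∀ x y, l i x = 0 → l j x = 0 → l i y = 0 → l j y = 0 → x = y)
    (d : ι → ℝ) (x : V2) (hd : AnalyticAt ℝ (fun z => ∑ i, d i * tp (l i z)) x)
    (i : ι) (hi : l i x = 0) : d i = 0 := by
  classical
  obtain ⟨e, n, he, hφe, hφn, -⟩ := exists_coords (l i).linear (hne i)
  have hcont : Tendsto (fun s : ℝ => x + s • e) (𝓝[≠] 0) (𝓝 x) := by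
    have : Continuous fun s : ℝ => x + s • e := by fun_prop
    have h := this.tendsto 0
    simp only [zero_smul, add_zero] at h
    exact h.mono_left nhdsWithin_le_nhds
  have h1 := hcont.eventually hd.eventually_analyticAt
  have h2 : ∀ᶠ s : ℝ in 𝓝[≠] 0, ∀ j, j ≠ i → l j (x + s • e) ≠ 0 := by
    rw [eventually_all]
    intro j
    by_cases hj : l j x = 0
    · filter_upwards [self_mem_nhdsWithin] with s hs hji h0
      have hx := hH i j hji.symm x (x + s • e) hi hj
        (by rw [aff_add, map_smul, hφe, hi]; simp) h0
      have : s • e = 0 := by simpa using hx.symm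
      rcases smul_eq_zero.1 this with h | h
      · exact hs h
      · exact he h
    · have := hcont.eventually ((aff_cont (l j)).continuousAt.eventually_ne hj)
      filter_upwards [this] with s hs _ using hs
  obtain ⟨s, hs1, hs2⟩ := (h1.and h2).exists
  set y := x + s • e with hy
  have hiy : l i y = 0 := by rw [hy, aff_add, map_smul, hφe, hi]; simp
  have h3 : AnalyticAt ℝ (fun z => d i * tp (l i z)) y := by
    have h4 : AnalyticAt ℝ (fun z => ∑ j ∈ Finset.univ.erase i, d j * tp (l j z)) y := by
      apply Finset.analyticAt_fun_sum
      intro j hj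
      exact analyticAt_const.mul (tp_aff_analytic _ _ (hs2 j (Finset.ne_of_mem_erase hj)))
    have h5 := hs1.sub h4
    refine h5.congr (Eventually.of_forall fun z => ?_)
    simp only [Pi.sub_apply]
    rw [← Finset.add_sum_erase _ _ (Finset.mem_univ i)]
    ring
  have h6 : AnalyticAt ℝ (fun t : ℝ => d i * tp t) 0 := by
    have h7 : AnalyticAt ℝ (fun t : ℝ => y + t • n) 0 := by fun_prop
    have := AnalyticAt.comp_of_eq h3 h7 (by simp)
    refine this.congr (Eventually.of_forall fun t => ?_)
    simp [Function.comp, aff_add, hiy, hφn]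
  have h9 : ∃ᶠ t in 𝓝[≠] (0 : ℝ), d i * tp t = 0 := by
    have : ∃ᶠ t in 𝓝[<] (0 : ℝ), d i * tp t = 0 := by
      apply Eventually.frequently
      filter_upwards [self_mem_nhdsWithin] with t ht
      rw [tp_of_nonpos (le_of_lt ht), mul_zero]
    exact this.filter_mono (nhdsWithin_mono _ fun t ht => ne_of_lt ht)
  have h10 := (h6.frequently_zero_iff_eventually_zero).1 h9
  have h11 : ∀ᶠ t in 𝓝[>] (0 : ℝ), d i * tp t = 0 := h10.filter_mono nhdsWithin_le_nhds
  obtain ⟨t, ht, ht0⟩ := (h11.and self_mem_nhdsWithin).exists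
  have ht0' : (0 : ℝ) < t := ht0
  rw [tp_of_nonneg ht0'.le] at ht
  rcases mul_eq_zero.1 ht with h | h
  · exact h
  · exact absurd h (by positivity)

lemma local_to_global (l : ι → V2 →ᵃ[ℝ] ℝ) (hne : ∀ i, (l i).linear ≠ 0)
    (hH : ∀ i j, i ≠ j → ∀ x y, l i x = 0 → l j x = 0 → l i y = 0 → l j y = 0 → x = y)
    (U : Set V2) (hUc : Convex ℝ U) (f : V2 → ℝ)
    (hf : ∀ x ∈ U, ∃ c : ι → ℝ, AnalyticAt ℝ (fun z => f z - ∑ i, c i * tp (l i z)) x) :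
    ∃ c : ι → ℝ, ∀ x ∈ U, AnalyticAt ℝ (fun z => f z - ∑ i, c i * tp (l i z)) x := by
  classical
  choose! c hc using hf
  have hdiff : ∀ (a b : ι → ℝ) (x : V2),
      AnalyticAt ℝ (fun z => f z - ∑ i, a i * tp (l i z)) x →
      AnalyticAt ℝ (fun z => f z - ∑ i, b i * tp (l i z)) x →
      ∀ i, l i x = 0 → a i = b i := by
    intro a b x ha hb i hi
    have := coeff_unique l hne hH (fun i => b i - a i) x ?_ i hi
    · linarith
    · refine (ha.sub hb).congr (Eventually.of_forall fun z => ?_)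
      simp only [Pi.sub_apply, sub_mul, Finset.sum_sub_distrib]
      ring
  have hconst : ∀ i, ∀ x ∈ U ∩ {z | l i z = 0}, ∀ y ∈ U ∩ {z | l i z = 0}, c x i = c y i := by
    intro i x hx y hy
    have hconv : Convex ℝ (U ∩ {z | l i z = 0}) := by
      refine hUc.inter ?_
      have := (convex_singleton (𝕜 := ℝ) (0 : ℝ)).affine_preimage (l i)
      exact this
    refine hconv.isPreconnected.induction₂ (fun x y => c x i = c y i) ?_ ?_ ?_ hx hy
    · intro x hx
      have h1 : ∀ᶠ y in 𝓝[U ∩ {z | l i z = 0}] x,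
          AnalyticAt ℝ (fun z => f z - ∑ i, c x i * tp (l i z)) y :=
        (hc x hx.1).eventually_analyticAt.filter_mono nhdsWithin_le_nhds
      filter_upwards [h1, self_mem_nhdsWithin] with y hy1 hy2
      exact hdiff _ _ y hy1 (hc y hy2.1) i hy2.2
    · intro x y z _ _ _ h1 h2
      exact h1.trans h2
    · intro x y _ _ h
      exact h.symm
  let C : ι → ℝ := fun i =>
    if h : (U ∩ {z | l i z = 0}).Nonempty then c h.some i else 0
  refine ⟨C, fun x hx => ?_⟩
  have h1 : AnalyticAt ℝ (fun z => ∑ i, (c x i - C i) * tp (l i z)) x := by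
    apply Finset.analyticAt_fun_sum
    intro i _
    by_cases hi : l i x = 0
    · have hn : (U ∩ {z | l i z = 0}).Nonempty := ⟨x, hx, hi⟩
      have : C i = c x i := by
        simp only [C, dif_pos hn]
        exact hconst i _ hn.some_mem _ ⟨hx, hi⟩
      simp only [this, sub_self, zero_mul]
      exact analyticAt_const
    · exact analyticAt_const.mul (tp_aff_analytic _ _ hi)
  refine ((hc x hx).add h1).congr (Eventually.of_forall fun z => ?_)
  simp only [Pi.add_apply, sub_mul, Finset.sum_sub_distrib]
  ring

/-- `f` is cubic on the cells of the arrangement inside `U`. -/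
def PW (l : ι → V2 →ᵃ[ℝ] ℝ) (U : Set V2) (f : V2 → ℝ) : Prop :=
  ∀ x ∈ U, (∀ i, l i x ≠ 0) → ∃ P, Cub P ∧ ∀ z ∈ U, (∀ i, 0 < l i z * l i x) → f z = P z

lemma exists_off_lines (l : ι → V2 →ᵃ[ℝ] ℝ) (hne : ∀ i, (l i).linear ≠ 0)
    (U : Set V2) (hUo : IsOpen U) (hU : U.Nonempty) : ∃ x ∈ U, ∀ i, l i x ≠ 0 := by
  have hd : Dense (⋂ i, {x | l i x ≠ 0}) := by
    apply dense_iInter_of_isOpen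
    · intro i
      exact isOpen_ne_fun (aff_cont (l i)) continuous_const
    · intro i x
      obtain ⟨e, n, he, hφe, hφn, -⟩ := exists_coords (l i).linear (hne i)
      by_cases hx : l i x = 0
      · have hcont : Tendsto (fun s : ℝ => x + s • n) (𝓝[≠] 0) (𝓝 x) := by
          have : Continuous fun s : ℝ => x + s • n := by fun_prop
          have h := this.tendsto 0
          simp only [zero_smul, add_zero] at h
          exact h.mono_left nhdsWithin_le_nhds
        refine mem_closure_of_tendsto hcont ?_
        filter_upwards [self_mem_nhdsWithin] with s hs
        simpa [aff_add, hφn, hx] using hs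
      · exact subset_closure hx
  obtain ⟨x, hx1, hx2⟩ := hd.inter_open_nonempty U hUo hU
  exact ⟨x, hx1, by simpa using hx2⟩

lemma global_form (l : ι → V2 →ᵃ[ℝ] ℝ) (hne : ∀ i, (l i).linear ≠ 0)
    (hH : ∀ i j, i ≠ j → ∀ x y, l i x = 0 → l j x = 0 → l i y = 0 → l j y = 0 → x = y)
    (U : Set V2) (hUc : Convex ℝ U) (hUo : IsOpen U) (hU : U.Nonempty) (f : V2 → ℝ)
    (hpw : PW l U f)
    (hf : ∀ x ∈ U, ∃ c : ι → ℝ, AnalyticAt ℝ (fun z => f z - ∑ i, c i * tp (l i z)) x) :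
    ∃ (c : ι → ℝ) (P : V2 → ℝ), Cub P ∧ ∀ z ∈ U, f z = P z + ∑ i, c i * tp (l i z) := by
  classical
  obtain ⟨c, hc⟩ := local_to_global l hne hH U hUc f hf
  obtain ⟨x, hxU, hx⟩ := exists_off_lines l hne U hUo hU
  obtain ⟨P, hP, hfP⟩ := hpw x hxU hx
  let κ : ι → ℝ := fun i => if 0 < l i x then 1 else 0
  refine ⟨c, fun z => P z + ∑ i, (-c i * κ i) * (l i z) ^ 3,
    hP.add (Cub.sum _ _ fun i _ => (Cub.cube (l i)).smul _), ?_⟩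
  have hQ : Cub (fun z => P z + ∑ i, (-c i * κ i) * (l i z) ^ 3) :=
    hP.add (Cub.sum _ _ fun i _ => (Cub.cube (l i)).smul _)
  have hev : ∀ᶠ z in 𝓝 x, ∀ i, 0 < l i z * l i x := by
    rw [eventually_all]
    intro i
    have h1 : Continuous fun z => l i z * l i x := (aff_cont (l i)).mul continuous_const
    exact h1.continuousAt.eventually (eventually_gt_nhds (mul_self_pos.2 (hx i)))
  have key : Set.EqOn (fun z => f z - ∑ i, c i * tp (l i z))
      (fun z => P z + ∑ i, (-c i * κ i) * (l i z) ^ 3) U := by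
    refine AnalyticOnNhd.eqOn_of_preconnected_of_eventuallyEq (𝕜 := ℝ) hc
      (fun z _ => hQ.analyticAt z) hUc.isPreconnected hxU ?_
    filter_upwards [hev, hUo.mem_nhds hxU] with z hz hzU
    rw [hfP z hzU hz, sub_eq_add_neg, ← Finset.sum_neg_distrib]
    congr 1
    refine Finset.sum_congr rfl fun i _ => ?_
    have hzi := hz i
    by_cases hi : 0 < l i x
    · have : 0 < l i z := pos_of_mul_pos_left hzi hi.le
      simp [κ, hi, tp_of_nonneg this.le]
    · have h0 : l i x < 0 := lt_of_le_of_ne (not_lt.1 hi) (hx i)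
      have : l i z < 0 := by nlinarith
      simp [κ, hi, tp_of_nonpos this.le]
  intro z hz
  have := key hz
  simp only at this ⊢
  linarith

end arrangement

/-! ### Matching across a line -/

lemma jet_side (S : Set ℝ) (hS : IsOpen S) [(𝓝[S] (0 : ℝ)).NeBot] (φ : ℝ → ℝ) (W : Set ℝ)
    (hW : IsOpen W) (h0 : (0 : ℝ) ∈ W) (hφ : ContDiffOn ℝ 2 φ W) (a0 a1 a2 a3 : ℝ)
    (h : ∀ᶠ t in 𝓝[S] (0 : ℝ), φ t = a0 + a1 * t + a2 * t ^ 2 + a3 * t ^ 3) :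
    φ 0 = a0 ∧ deriv φ 0 = a1 ∧ deriv (deriv φ) 0 = 2 * a2 := by
  have hstep : ∀ ψ q : ℝ → ℝ, ψ =ᶠ[𝓝[S] 0] q → deriv ψ =ᶠ[𝓝[S] 0] deriv q := by
    intro ψ q hq
    have := eventually_eventually_nhdsWithin.2 hq
    filter_upwards [this, self_mem_nhdsWithin] with t ht htS
    rw [hS.nhdsWithin_eq htS] at ht
    exact Filter.EventuallyEq.deriv_eq ht
  have hval : ∀ ψ q : ℝ → ℝ, ContinuousAt ψ 0 → ContinuousAt q 0 → ψ =ᶠ[𝓝[S] 0] q →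
      ψ 0 = q 0 := by
    intro ψ q h1 h2 h3
    have h4 : Tendsto ψ (𝓝[S] 0) (𝓝 (ψ 0)) := h1.mono_left nhdsWithin_le_nhds
    have h5 : Tendsto q (𝓝[S] 0) (𝓝 (q 0)) := h2.mono_left nhdsWithin_le_nhds
    exact tendsto_nhds_unique (h4.congr' h3) h5
  have c1 : ContDiffOn ℝ 1 (deriv φ) W := hφ.deriv_of_isOpen hW (by norm_num)
  have c2 : ContDiffOn ℝ 0 (deriv (deriv φ)) W := c1.deriv_of_isOpen hW (by norm_num)
  have hWn := hW.mem_nhds h0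
  have k0 : ContinuousAt φ 0 := hφ.continuousOn.continuousAt hWn
  have k1 : ContinuousAt (deriv φ) 0 := c1.continuousOn.continuousAt hWn
  have k2 : ContinuousAt (deriv (deriv φ)) 0 := c2.continuousOn.continuousAt hWn
  have e1 : deriv (fun t : ℝ => a0 + a1 * t + a2 * t ^ 2 + a3 * t ^ 3)
      = fun t => a1 + 2 * a2 * t + 3 * a3 * t ^ 2 := by
    ext t
    have h1 : HasDerivAt (fun t : ℝ => a0 + a1 * t + a2 * t ^ 2 + a3 * t ^ 3)
      (0 + a1 * 1 + a2 * (2 * t) + a3 * (3 * t ^ 2)) t := by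
      refine (((hasDerivAt_const t a0).add ((hasDerivAt_id t).const_mul a1)).add ?_).add ?_
      · simpa using (hasDerivAt_pow 2 t).const_mul a2
      · simpa using (hasDerivAt_pow 3 t).const_mul a3
    rw [h1.deriv]; ring
  have e2 : deriv (fun t : ℝ => a1 + 2 * a2 * t + 3 * a3 * t ^ 2)
      = fun t => 2 * a2 + 6 * a3 * t := by
    ext t
    have h1 : HasDerivAt (fun t : ℝ => a1 + 2 * a2 * t + 3 * a3 * t ^ 2)
      (0 + 2 * a2 * 1 + 3 * a3 * (2 * t)) t := by
      refine ((hasDerivAt_const t a1).add ((hasDerivAt_id t).const_mul _)).add ?_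
      simpa using (hasDerivAt_pow 2 t).const_mul (3 * a3)
    rw [h1.deriv]; ring
  have h' : φ =ᶠ[𝓝[S] 0] (fun t : ℝ => a0 + a1 * t + a2 * t ^ 2 + a3 * t ^ 3) := h
  have h1 := hstep _ _ h'
  rw [e1] at h1
  have h2 := hstep _ _ h1
  rw [e2] at h2
  refine ⟨?_, ?_, ?_⟩
  · have := hval _ _ k0 (by fun_prop) h'
    simpa using this
  · have := hval _ _ k1 (by fun_prop) h1
    simpa using this
  · have := hval _ _ k2 (by fun_prop) h2
    simpa using this

lemma jet_match (φ : ℝ → ℝ) (W : Set ℝ)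
    (hW : IsOpen W) (h0 : (0 : ℝ) ∈ W) (hφ : ContDiffOn ℝ 2 φ W) (a0 a1 a2 a3 b0 b1 b2 b3 : ℝ)
    (ha : ∀ᶠ t in 𝓝[>] (0 : ℝ), φ t = a0 + a1 * t + a2 * t ^ 2 + a3 * t ^ 3)
    (hb : ∀ᶠ t in 𝓝[<] (0 : ℝ), φ t = b0 + b1 * t + b2 * t ^ 2 + b3 * t ^ 3) :
    a0 = b0 ∧ a1 = b1 ∧ a2 = b2 := by
  obtain ⟨h1, h2, h3⟩ := jet_side (Set.Ioi 0) isOpen_Ioi φ W hW h0 hφ _ _ _ _ ha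
  obtain ⟨h4, h5, h6⟩ := jet_side (Set.Iio 0) isOpen_Iio φ W hW h0 hφ _ _ _ _ hb
  refine ⟨?_, ?_, ?_⟩ <;> linarith

lemma vdm {ι : Type*} (I : Finset ι) (hI : I.card ≤ 3) (a e : ι → ℝ)
    (ha : ∀ i ∈ I, ∀ j ∈ I, a i = a j → i = j)
    (h0 : ∑ i ∈ I, e i = 0) (h1 : ∑ i ∈ I, e i * a i = 0) (h2 : ∑ i ∈ I, e i * a i ^ 2 = 0) :
    ∀ i ∈ I, e i = 0 := by
  classical
  intro i hi
  let q : Polynomial ℝ := ∏ j ∈ I.erase i, (Polynomial.X - Polynomial.C (a j))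
  have hq : q.natDegree < 3 := by
    have : q.natDegree = (I.erase i).card := by
      simp only [q]
      rw [Polynomial.natDegree_prod_of_monic _ _ fun j _ => Polynomial.monic_X_sub_C _]
      simp
    rw [this, Finset.card_erase_of_mem hi]
    have : 0 < I.card := Finset.card_pos.2 ⟨i, hi⟩
    omega
  have hsum : ∑ k ∈ I, e k * q.eval (a k) = 0 := by
    have : ∀ k, e k * q.eval (a k)
        = q.coeff 0 * e k + q.coeff 1 * (e k * a k) + q.coeff 2 * (e k * a k ^ 2) := by
      intro k
      rw [Polynomial.eval_eq_sum_range' hq]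
      simp [Finset.sum_range_succ]
      ring
    simp only [this, Finset.sum_add_distrib, ← Finset.mul_sum, h0, h1, h2]
    simp
  rw [Finset.sum_eq_single_of_mem i hi] at hsum
  · rcases mul_eq_zero.1 hsum with h | h
    · exact h
    · exfalso
      simp only [q, Polynomial.eval_prod, Finset.prod_eq_zero_iff] at h
      obtain ⟨j, hj, hj0⟩ := h
      simp only [Polynomial.eval_sub, Polynomial.eval_X, Polynomial.eval_C] at hj0
      rw [Finset.mem_erase] at hj
      exact hj.1 (ha i hi j hj.2 (by linarith)).symm
  · intro j hj hji
    have : q.eval (a j) = 0 := by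
      simp only [q, Polynomial.eval_prod, Finset.prod_eq_zero_iff]
      exact ⟨j, Finset.mem_erase.2 ⟨hji, hj⟩, by simp⟩
    rw [this, mul_zero]

lemma cube_sum {ι : Type*} (I : Finset ι) (w α β : ι → ℝ) (s t : ℝ) :
    ∑ i ∈ I, w i * (α i * s + β i * t) ^ 3 = (∑ i ∈ I, w i * α i ^ 3) * s ^ 3
      + 3 * (∑ i ∈ I, w i * (α i ^ 2 * β i)) * s ^ 2 * t
      + 3 * (∑ i ∈ I, w i * (α i * β i ^ 2)) * s * t ^ 2 + (∑ i ∈ I, w i * β i ^ 3) * t ^ 3 := by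
  simp only [Finset.mul_sum, Finset.sum_mul, ← Finset.sum_add_distrib]
  exact Finset.sum_congr rfl fun i _ => by ring

lemma poly_zero (ε A B C D : ℝ) (hε : 0 < ε)
    (h : ∀ s, 0 < s → s < ε → A + B * s + C * s ^ 2 + D * s ^ 3 = 0) :
    A = 0 ∧ B = 0 ∧ C = 0 ∧ D = 0 := by
  have h1 := h (ε / 5) (by linarith) (by linarith)
  have h2 := h (2 * (ε / 5)) (by linarith) (by linarith)
  have h3 := h (3 * (ε / 5)) (by linarith) (by linarith)
  have h4 := h (4 * (ε / 5)) (by linarith) (by linarith)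
  have hδ : ε / 5 ≠ 0 := by positivity
  generalize ε / 5 = δ at *
  have eA : A = 0 := by linear_combination 4 * h1 - 6 * h2 + 4 * h3 - h4
  subst eA
  have eB : B * δ = 0 := by linear_combination 3 * h1 - (3/2) * h2 + (1/3) * h3
  have eC : C * δ ^ 2 = 0 := by linear_combination (-5/2) * h1 + 2 * h2 - (1/2) * h3
  have eD : D * δ ^ 3 = 0 := by linear_combination (1/2) * h1 - (1/2) * h2 + (1/6) * h3
  simp [hδ] at eB eC eD
  exact ⟨rfl, eB, eC, eD⟩

lemma match_line {ι : Type*} (x : V2) (r : ℝ) (hr : 0 < r) (L : V2 →ᵃ[ℝ] ℝ) (hL : L.linear ≠ 0)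
    (hLx : L x = 0) (I : Finset ι) (hI : I.card ≤ 3) (l : ι → V2 →ᵃ[ℝ] ℝ)
    (hx : ∀ i ∈ I, l i x = 0) (hLI : ∀ i ∈ I, ∀ y, L y = 0 → l i y = 0 → y = x)
    (hij : ∀ i ∈ I, ∀ j ∈ I, i ≠ j → ∀ y, l i y = 0 → l j y = 0 → y = x)
    (f : V2 → ℝ) (hf : ContDiffOn ℝ 2 f (Metric.ball x r)) (P Q : V2 → ℝ) (hP : Cub P)
    (hQ : Cub Q) (j j' : ι → ℝ)
    (hup : ∀ z ∈ Metric.ball x r, 0 < L z → f z = P z + ∑ i ∈ I, j i * tp (l i z))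
    (hlow : ∀ z ∈ Metric.ball x r, L z < 0 → f z = Q z + ∑ i ∈ I, j' i * tp (l i z)) :
    ∃ c : ℝ, ∀ z ∈ Metric.ball x r,
      f z = Q z + c * tp (L z) + ∑ i ∈ I, j i * tp (l i z) := by
  classical
  obtain ⟨e, n, he, hLe, hLn, hcoord⟩ := exists_coords L.linear hL
  obtain ⟨p, hp⟩ := hP x e n
  obtain ⟨q, hq⟩ := hQ x e n
  set α : ι → ℝ := fun i => (l i).linear e with hα
  set β : ι → ℝ := fun i => (l i).linear n with hβ
  have hLst : ∀ s t : ℝ, L (x + s • e + t • n) = t := by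
    intro s t; simp [aff_add, hLx, hLe, hLn]
  have hlst : ∀ i ∈ I, ∀ s t : ℝ, l i (x + s • e + t • n) = α i * s + β i * t := by
    intro i hi s t; simp [aff_add, hx i hi, α, β]; ring
  have hα0 : ∀ i ∈ I, α i ≠ 0 := by
    intro i hi h0
    have := hLI i hi (x + e) (by simp [aff_add, hLx, hLe]) (by
      rw [aff_add, hx i hi]; simpa [α] using h0)
    exact he (by simpa using this)
  have hcont : ∀ s : ℝ, Continuous fun t : ℝ => x + s • e + t • n := fun s => by fun_prop
  have hεex : ∃ ε > 0, ∀ s : ℝ, |s| < ε → x + s • e ∈ Metric.ball x r := by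
    have h1 : Continuous fun s : ℝ => x + s • e := by fun_prop
    have h2 : ∀ᶠ s in 𝓝 (0 : ℝ), x + s • e ∈ Metric.ball x r :=
      h1.continuousAt.eventually (Metric.isOpen_ball.mem_nhds (by simpa using hr))
    obtain ⟨ε, hε, h⟩ := Metric.eventually_nhds_iff.1 h2
    exact ⟨ε, hε, fun s hs => h (by simpa using hs)⟩
  obtain ⟨ε, hε, hball⟩ := hεex
  -- jets along transversal lines
  have key : ∀ s : ℝ, s ≠ 0 → |s| < ε → ∀ κ : ι → ℝ,
      (∀ i ∈ I, κ i = if 0 < α i * s then 1 else 0) →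
      (p 0 - q 0) + (p 1 - q 1) * s + (p 3 - q 3) * s ^ 2
        + ((p 6 - q 6) + ∑ i ∈ I, (j i - j' i) * κ i * α i ^ 3) * s ^ 3 = 0 ∧
      (p 2 - q 2) + (p 4 - q 4) * s
        + ((p 7 - q 7) + 3 * ∑ i ∈ I, (j i - j' i) * κ i * (α i ^ 2 * β i)) * s ^ 2 = 0 ∧
      (p 5 - q 5) + ((p 8 - q 8) + 3 * ∑ i ∈ I, (j i - j' i) * κ i * (α i * β i ^ 2)) * s
        = 0 := by
    intro s hs hsε κ hκ
    let φ : ℝ → ℝ := fun t => f (x + s • e + t • n)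
    let W : Set ℝ := (fun t : ℝ => x + s • e + t • n) ⁻¹' Metric.ball x r
    have hW : IsOpen W := Metric.isOpen_ball.preimage (hcont s)
    have h0W : (0 : ℝ) ∈ W := by
      have := hball s hsε
      simpa [W] using this
    have hφ : ContDiffOn ℝ 2 φ W := by
      refine hf.comp (t := Metric.ball x r) ?_ (fun t ht => ht)
      exact ContDiff.contDiffOn (by fun_prop)
    have hsign : ∀ᶠ t in 𝓝 (0 : ℝ), ∀ i ∈ I,
        tp (α i * s + β i * t) = κ i * (α i * s + β i * t) ^ 3 := by
      rw [Finset.eventually_all]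
      intro i hi
      have hc : Continuous fun t : ℝ => α i * s + β i * t := by fun_prop
      rcases lt_or_gt_of_ne (mul_ne_zero (hα0 i hi) hs) with h | h
      · filter_upwards [hc.continuousAt.eventually (eventually_lt_nhds (b := 0) (by simpa using h))]
          with t ht
        rw [hκ i hi, if_neg h.le.not_gt, tp_of_nonpos (le_of_lt ht), zero_mul]
      · filter_upwards [hc.continuousAt.eventually (eventually_gt_nhds (b := 0) (by simpa using h))]
          with t ht
        rw [hκ i hi, if_pos h, tp_of_nonneg (le_of_lt ht), one_mul]
    have hWe : ∀ᶠ t in 𝓝 (0 : ℝ), t ∈ W := hW.mem_nhds h0W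
    have gen : ∀ (g : ι → ℝ) (u : Fin 10 → ℝ) (t : ℝ),
        (∀ i ∈ I, tp (α i * s + β i * t) = κ i * (α i * s + β i * t) ^ 3) →
        cubEval u s t + ∑ i ∈ I, g i * tp (l i (x + s • e + t • n))
        = (u 0 + u 1 * s + u 3 * s ^ 2 + u 6 * s ^ 3 + (∑ i ∈ I, g i * κ i * α i ^ 3) * s ^ 3)
          + (u 2 + u 4 * s + u 7 * s ^ 2
            + 3 * (∑ i ∈ I, g i * κ i * (α i ^ 2 * β i)) * s ^ 2) * t
          + (u 5 + u 8 * s + 3 * (∑ i ∈ I, g i * κ i * (α i * β i ^ 2)) * s) * t ^ 2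
          + (u 9 + ∑ i ∈ I, g i * κ i * β i ^ 3) * t ^ 3 := by
      intro g u t ht
      have h1 : ∑ i ∈ I, g i * tp (l i (x + s • e + t • n))
          = ∑ i ∈ I, (g i * κ i) * (α i * s + β i * t) ^ 3 := by
        refine Finset.sum_congr rfl fun i hi => ?_
        rw [hlst i hi, ht i hi, mul_assoc]
      rw [h1, cube_sum]
      unfold cubEval
      ring
    have hsplit : ∀ w : ι → ℝ, ∑ i ∈ I, (j i - j' i) * κ i * w i
        = ∑ i ∈ I, j i * κ i * w i - ∑ i ∈ I, j' i * κ i * w i := by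
      intro w
      rw [← Finset.sum_sub_distrib]
      exact Finset.sum_congr rfl fun i _ => by ring
    have hup' : ∀ᶠ t in 𝓝[>] (0 : ℝ), φ t =
        ((p 0 + p 1 * s + p 3 * s ^ 2 + p 6 * s ^ 3 + (∑ i ∈ I, j i * κ i * α i ^ 3) * s ^ 3)
          + (p 2 + p 4 * s + p 7 * s ^ 2
            + 3 * (∑ i ∈ I, j i * κ i * (α i ^ 2 * β i)) * s ^ 2) * t
          + (p 5 + p 8 * s + 3 * (∑ i ∈ I, j i * κ i * (α i * β i ^ 2)) * s) * t ^ 2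
          + (p 9 + ∑ i ∈ I, j i * κ i * β i ^ 3) * t ^ 3) := by
      filter_upwards [hsign.filter_mono nhdsWithin_le_nhds, hWe.filter_mono nhdsWithin_le_nhds,
        self_mem_nhdsWithin] with t h1 h2 h3
      exact (hup _ h2 (by rw [hLst]; exact h3)).trans (by rw [hp]; exact gen j p t h1)
    have hlow' : ∀ᶠ t in 𝓝[<] (0 : ℝ), φ t =
        ((q 0 + q 1 * s + q 3 * s ^ 2 + q 6 * s ^ 3 + (∑ i ∈ I, j' i * κ i * α i ^ 3) * s ^ 3)
          + (q 2 + q 4 * s + q 7 * s ^ 2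
            + 3 * (∑ i ∈ I, j' i * κ i * (α i ^ 2 * β i)) * s ^ 2) * t
          + (q 5 + q 8 * s + 3 * (∑ i ∈ I, j' i * κ i * (α i * β i ^ 2)) * s) * t ^ 2
          + (q 9 + ∑ i ∈ I, j' i * κ i * β i ^ 3) * t ^ 3) := by
      filter_upwards [hsign.filter_mono nhdsWithin_le_nhds, hWe.filter_mono nhdsWithin_le_nhds,
        self_mem_nhdsWithin] with t h1 h2 h3
      exact (hlow _ h2 (by rw [hLst]; exact h3)).trans (by rw [hq]; exact gen j' q t h1)
    obtain ⟨e0, e1, e2⟩ := jet_match φ W hW h0W hφ _ _ _ _ _ _ _ _ hup' hlow'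
    rw [hsplit, hsplit, hsplit]
    refine ⟨?_, ?_, ?_⟩
    · linear_combination e0
    · linear_combination e1
    · linear_combination e2
  let κp : ι → ℝ := fun i => if 0 < α i then 1 else 0
  let κm : ι → ℝ := fun i => if 0 < -α i then 1 else 0
  have kp : ∀ s, 0 < s → ∀ i ∈ I, κp i = if 0 < α i * s then 1 else 0 := by
    intro s hs i _
    simp only [κp, mul_pos_iff_of_pos_right hs]
  have km : ∀ s, 0 < s → ∀ i ∈ I, κm i = if 0 < α i * (-s) then 1 else 0 := by
    intro s hs i _
    have : α i * (-s) = (-α i) * s := by ring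
    simp only [κm, this, mul_pos_iff_of_pos_right hs]
  have a0 := poly_zero ε _ _ _ _ hε fun s h1 h2 =>
    (key s h1.ne' (by rwa [abs_of_pos h1]) κp (kp s h1)).1
  have a1 := poly_zero ε (p 2 - q 2) (p 4 - q 4)
      ((p 7 - q 7) + 3 * ∑ i ∈ I, (j i - j' i) * κp i * (α i ^ 2 * β i)) 0 hε fun s h1 h2 => by
    rw [zero_mul, add_zero]
    exact (key s h1.ne' (by rwa [abs_of_pos h1]) κp (kp s h1)).2.1
  have a2 := poly_zero ε (p 5 - q 5)
      ((p 8 - q 8) + 3 * ∑ i ∈ I, (j i - j' i) * κp i * (α i * β i ^ 2)) 0 0 hε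
      fun s h1 h2 => by
    rw [zero_mul, add_zero, zero_mul, add_zero]
    exact (key s h1.ne' (by rwa [abs_of_pos h1]) κp (kp s h1)).2.2
  have b0 := poly_zero ε (p 0 - q 0) (-(p 1 - q 1)) (p 3 - q 3)
      (-((p 6 - q 6) + ∑ i ∈ I, (j i - j' i) * κm i * α i ^ 3)) hε fun s h1 h2 => by
    have := (key (-s) (by simpa using h1.ne') (by rwa [abs_neg, abs_of_pos h1]) κm (km s h1)).1
    linear_combination this
  have b1 := poly_zero ε (p 2 - q 2) (-(p 4 - q 4))
      ((p 7 - q 7) + 3 * ∑ i ∈ I, (j i - j' i) * κm i * (α i ^ 2 * β i)) 0 hε fun s h1 h2 => by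
    have := (key (-s) (by simpa using h1.ne') (by rwa [abs_neg, abs_of_pos h1]) κm (km s h1)).2.1
    linear_combination this
  have b2 := poly_zero ε (p 5 - q 5)
      (-((p 8 - q 8) + 3 * ∑ i ∈ I, (j i - j' i) * κm i * (α i * β i ^ 2))) 0 0 hε
      fun s h1 h2 => by
    have := (key (-s) (by simpa using h1.ne') (by rwa [abs_neg, abs_of_pos h1]) κm (km s h1)).2.2
    linear_combination this
  have hsub : ∀ w : ι → ℝ, ∑ i ∈ I, (j i - j' i) * (κp i - κm i) * w i
      = ∑ i ∈ I, (j i - j' i) * κp i * w i - ∑ i ∈ I, (j i - j' i) * κm i * w i := by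
    intro w
    rw [← Finset.sum_sub_distrib]
    exact Finset.sum_congr rfl fun i _ => by ring
  have hz := vdm I hI (fun i => β i / α i)
    (fun i => (j i - j' i) * (κp i - κm i) * α i ^ 3) ?_ ?_ ?_ ?_
  rotate_left
  · intro i hi k hk hik
    by_contra hne
    have := hij i hi k hk hne (x + (-(β i / α i)) • e + (1 : ℝ) • n)
      (by rw [hlst i hi]; have := hα0 i hi; field_simp; ring)
      (by rw [hlst k hk, hik]; have := hα0 k hk; field_simp; ring)
    have h1 := hLst (-(β i / α i)) 1
    rw [this, hLx] at h1
    exact zero_ne_one h1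
  · rw [hsub]; linarith [a0.2.2.2, b0.2.2.2]
  · have : ∀ i ∈ I, (j i - j' i) * (κp i - κm i) * α i ^ 3 * (β i / α i)
        = (j i - j' i) * (κp i - κm i) * (α i ^ 2 * β i) := by
      intro i hi
      have := hα0 i hi
      field_simp
    rw [Finset.sum_congr rfl this, hsub]
    linarith [a1.2.2.1, b1.2.2.1]
  · have : ∀ i ∈ I, (j i - j' i) * (κp i - κm i) * α i ^ 3 * (β i / α i) ^ 2
        = (j i - j' i) * (κp i - κm i) * (α i * β i ^ 2) := by
      intro i hi
      have := hα0 i hi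
      field_simp
    rw [Finset.sum_congr rfl this, hsub]
    linarith [a2.2.1, b2.2.1]
  have hjj : ∀ i ∈ I, j i = j' i := by
    intro i hi
    have h1 := hz i hi
    have h2 : κp i - κm i ≠ 0 := by
      rcases lt_or_gt_of_ne (hα0 i hi) with h | h
      · simp [κp, κm, h, h.le, h.not_gt]
      · simp [κp, κm, h, h.le, h.not_gt]
    have h3 := hα0 i hi
    rcases mul_eq_zero.1 h1 with h5 | h5
    · rcases mul_eq_zero.1 h5 with h6 | h6
      · linarith
      · exact absurd h6 h2
    · exact absurd h5 (pow_ne_zero 3 h3)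
  have hsz : ∀ w : ι → ℝ, ∑ i ∈ I, (j i - j' i) * κp i * w i = 0 := by
    intro w
    apply Finset.sum_eq_zero
    intro i hi
    rw [hjj i hi]; ring
  rw [hsz] at a0 a1 a2
  have hPQ : ∀ z, P z = Q z + (p 9 - q 9) * L z ^ 3 := by
    intro z
    obtain ⟨s, hs⟩ := hcoord (z - x)
    have hzz : z = x + s • e + (L.linear (z - x)) • n := by
      rw [add_assoc, ← hs]; abel
    generalize L.linear (z - x) = t at hzz
    rw [hzz, hLst, hp, hq]
    obtain ⟨h1, h2, h3, h4⟩ := a0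
    obtain ⟨h5, h6, h7, -⟩ := a1
    obtain ⟨h8, h9, -, -⟩ := a2
    unfold cubEval
    linear_combination h1 + s * h2 + s ^ 2 * h3 + s ^ 3 * h4 + t * h5 + s * t * h6
      + s ^ 2 * t * h7 + t ^ 2 * h8 + s * t ^ 2 * h9
  have hpos : ∀ z ∈ Metric.ball x r, 0 < L z →
      f z = Q z + (p 9 - q 9) * tp (L z) + ∑ i ∈ I, j i * tp (l i z) := by
    intro z hz h
    rw [hup z hz h, hPQ, tp_of_nonneg h.le]
  refine ⟨p 9 - q 9, fun z hz => ?_⟩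
  rcases lt_trichotomy (L z) 0 with h | h | h
  · rw [hlow z hz h, tp_of_nonpos h.le, mul_zero, add_zero]
    congr 1
    exact Finset.sum_congr rfl fun i hi => by rw [hjj i hi]
  · have hc : Continuous fun t : ℝ => z + t • n := by fun_prop
    have ht : Tendsto (fun t : ℝ => z + t • n) (𝓝[>] 0) (𝓝 z) := by
      have h := hc.tendsto 0
      simp only [zero_smul, add_zero] at h
      exact h.mono_left nhdsWithin_le_nhds
    have hfc : ContinuousAt f z :=
      hf.continuousOn.continuousAt (Metric.isOpen_ball.mem_nhds hz)
    have hgc : ContinuousAt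
        (fun z => Q z + (p 9 - q 9) * tp (L z) + ∑ i ∈ I, j i * tp (l i z)) z := by
      have hQc : ContinuousAt Q z := (hQ.analyticAt z).continuousAt
      have ht : ∀ m : V2 →ᵃ[ℝ] ℝ, Continuous fun z => tp (m z) :=
        fun m => contDiff_tp.continuous.comp (aff_cont m)
      refine (hQc.add ((ht L).continuousAt.const_mul _)).add ?_
      exact (continuous_finsetSum _ fun i _ => continuous_const.mul (ht (l i))).continuousAt
    refine tendsto_nhds_unique (hfc.tendsto.comp ht) ((hgc.tendsto.comp ht).congr' ?_)
    filter_upwards [ht.eventually (Metric.isOpen_ball.mem_nhds hz), self_mem_nhdsWithin]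
      with t h1 h2
    refine (hpos _ h1 ?_).symm
    rw [aff_add, h, map_smul, hLn]
    simpa using h2
  · exact hpos z hz h

/-! ### The arrangement theorem -/

lemma good_ball {ι : Type*} [Fintype ι] (l : ι → V2 →ᵃ[ℝ] ℝ) (U : Set V2) (hUo : IsOpen U)
    (x : V2) (hx : x ∈ U) :
    ∃ r > 0, Metric.ball x r ⊆ U ∧
      ∀ i, l i x ≠ 0 → ∀ z ∈ Metric.ball x r, 0 < l i z * l i x := by
  have h1 : ∀ᶠ z in 𝓝 x, ∀ i, l i x ≠ 0 → 0 < l i z * l i x := by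
    rw [eventually_all]
    intro i
    by_cases h : l i x = 0
    · exact Eventually.of_forall fun z h' => absurd h h'
    · have hc : Continuous fun z => l i z * l i x := (aff_cont (l i)).mul continuous_const
      have : 0 < l i x * l i x := mul_self_pos.2 h
      filter_upwards [hc.continuousAt.eventually (eventually_gt_nhds this)] with z hz _
      exact hz
  obtain ⟨r, hr, h⟩ := Metric.eventually_nhds_iff_ball.1 (h1.and (hUo.mem_nhds hx))
  exact ⟨r, hr, fun z hz => (h z hz).2, fun i hi z hz => (h z hz).1 i hi⟩

lemma absorb {ι : Type*} [Fintype ι] [DecidableEq ι] (l : ι → V2 →ᵃ[ℝ] ℝ) (B : Set V2)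
    (I : Finset ι) (κ j : ι → ℝ) (P : V2 → ℝ) (hP : Cub P) (f : V2 → ℝ)
    (hκ : ∀ i ∉ I, ∀ z ∈ B, tp (l i z) = κ i * l i z ^ 3)
    (hf : ∀ z ∈ B, f z = P z + ∑ i, j i * tp (l i z)) :
    ∃ P', Cub P' ∧ ∀ z ∈ B, f z = P' z + ∑ i ∈ I, j i * tp (l i z) := by
  refine ⟨fun z => P z + ∑ i ∈ Iᶜ, (j i * κ i) * l i z ^ 3,
    hP.add (Cub.sum _ _ fun i _ => (Cub.cube (l i)).smul _), fun z hz => ?_⟩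
  rw [hf z hz, ← Finset.sum_add_sum_compl I]
  have : ∑ i ∈ Iᶜ, j i * tp (l i z) = ∑ i ∈ Iᶜ, (j i * κ i) * l i z ^ 3 :=
    Finset.sum_congr rfl fun i hi => by
      rw [hκ i (Finset.mem_compl.1 hi) z hz, mul_assoc]
  rw [this]; ring

lemma loc_finish {ι : Type*} [Fintype ι] (l : ι → V2 →ᵃ[ℝ] ℝ)
    (hne : ∀ i, (l i).linear ≠ 0)
    (hH : ∀ i j, i ≠ j → ∀ x y, l i x = 0 → l j x = 0 → l i y = 0 → l j y = 0 → x = y)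
    (x : V2) (r : ℝ) (hr : 0 < r) (i0 : ι) (h0 : l i0 x = 0)
    (hgood : ∀ i, l i x ≠ 0 → ∀ z ∈ Metric.ball x r, 0 < l i z * l i x)
    (hcard : ∀ S : Finset ι, (∀ i ∈ S, l i x = 0) → S.card ≤ 4)
    (f : V2 → ℝ) (hf : ContDiffOn ℝ 2 f (Metric.ball x r))
    (P Q : V2 → ℝ) (hP : Cub P) (hQ : Cub Q) (j j' : ι → ℝ)
    (hup : ∀ z ∈ Metric.ball x r ∩ {z | 0 < l i0 z}, f z = P z + ∑ i, j i * tp (l i z))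
    (hlow : ∀ z ∈ Metric.ball x r ∩ {z | l i0 z < 0}, f z = Q z + ∑ i, j' i * tp (l i z)) :
    ∃ c : ι → ℝ, AnalyticAt ℝ (fun z => f z - ∑ i, c i * tp (l i z)) x := by
  classical
  let I : Finset ι := Finset.univ.filter fun i => l i x = 0 ∧ i ≠ i0
  have hI0 : i0 ∉ I := by simp [I]
  have hIx : ∀ i ∈ I, l i x = 0 := fun i hi => (Finset.mem_filter.1 hi).2.1
  have hIn : ∀ i ∈ I, i ≠ i0 := fun i hi => (Finset.mem_filter.1 hi).2.2
  have hIc : I.card ≤ 3 := by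
    have := hcard (insert i0 I) (by
      intro i hi
      rcases Finset.mem_insert.1 hi with h | h
      · rw [h, h0]
      · exact hIx i h)
    rw [Finset.card_insert_of_notMem hI0] at this
    omega
  have hgen : ∀ i ∉ I, i ≠ i0 → ∀ z ∈ Metric.ball x r,
      tp (l i z) = (if 0 < l i x then 1 else 0) * l i z ^ 3 := by
    intro i hi hi0 z hz
    have hix : l i x ≠ 0 := fun h => hi (by simp [I, h, hi0])
    have := hgood i hix z hz
    rcases lt_or_gt_of_ne hix with h | h
    · rw [if_neg h.not_gt, zero_mul, tp_of_nonpos]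
      nlinarith
    · rw [if_pos h, one_mul, tp_of_nonneg]
      nlinarith
  obtain ⟨P', hP', hup'⟩ := absorb l _ I
    (fun i => if i = i0 then 1 else if 0 < l i x then 1 else 0) j P hP f (by
      intro i hi z hz
      by_cases h : i = i0
      · subst h
        simp [tp_of_nonneg (le_of_lt hz.2)]
      · rw [if_neg h]; exact hgen i hi h z hz.1) hup
  obtain ⟨Q', hQ', hlow'⟩ := absorb l _ I
    (fun i => if i = i0 then 0 else if 0 < l i x then 1 else 0) j' Q hQ f (by
      intro i hi z hz
      by_cases h : i = i0
      · subst h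
        simp [tp_of_nonpos (le_of_lt hz.2)]
      · rw [if_neg h]; exact hgen i hi h z hz.1) hlow
  obtain ⟨c, hc⟩ := match_line x r hr (l i0) (hne i0) h0 I hIc l hIx
    (fun i hi y h1 h2 => hH i i0 (hIn i hi) y x h2 h1 (hIx i hi) h0)
    (fun i hi k hk hik y h1 h2 => hH i k hik y x h1 h2 (hIx i hi) (hIx k hk))
    f hf P' Q' hP' hQ' j j' (fun z hz h => hup' z ⟨hz, h⟩) (fun z hz h => hlow' z ⟨hz, h⟩)
  refine ⟨fun i => if i = i0 then c else if i ∈ I then j i else 0, ?_⟩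
  refine (hQ'.analyticAt x).congr ?_
  filter_upwards [Metric.ball_mem_nhds x hr] with z hz
  have hs : ∑ i, (if i = i0 then c else if i ∈ I then j i else 0) * tp (l i z)
      = c * tp (l i0 z) + ∑ i ∈ I, j i * tp (l i z) := by
    rw [← Finset.sum_subset (Finset.subset_univ (insert i0 I)), Finset.sum_insert hI0]
    · rw [if_pos rfl]
      congr 1
      exact Finset.sum_congr rfl fun i hi => by rw [if_neg (hIn i hi), if_pos hi]
    · intro i _ hi
      rw [Finset.mem_insert, not_or] at hi
      rw [if_neg hi.1, if_neg hi.2, zero_mul]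
  rw [hs, hc z hz]
  ring

lemma half_nonempty (L : V2 →ᵃ[ℝ] ℝ) (hL : L.linear ≠ 0) (x : V2) (hx : L x = 0) (r : ℝ)
    (hr : 0 < r) : (Metric.ball x r ∩ {z | 0 < L z}).Nonempty ∧
      (Metric.ball x r ∩ {z | L z < 0}).Nonempty := by
  obtain ⟨e, n, -, -, hn, -⟩ := exists_coords L.linear hL
  have hc : Continuous fun t : ℝ => x + t • n := by fun_prop
  have h2 : ∀ᶠ t in 𝓝 (0 : ℝ), x + t • n ∈ Metric.ball x r :=
    hc.continuousAt.eventually (Metric.isOpen_ball.mem_nhds (by simpa using hr))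
  have hv : ∀ t : ℝ, L (x + t • n) = t := by intro t; simp [aff_add, hx, hn]
  constructor
  · obtain ⟨t, ht, h⟩ := ((h2.filter_mono nhdsWithin_le_nhds).and
      (self_mem_nhdsWithin : Set.Ioi (0 : ℝ) ∈ 𝓝[>] 0)).exists
    exact ⟨_, ht, by rw [Set.mem_setOf_eq, hv]; exact h⟩
  · obtain ⟨t, ht, h⟩ := ((h2.filter_mono nhdsWithin_le_nhds).and
      (self_mem_nhdsWithin : Set.Iio (0 : ℝ) ∈ 𝓝[<] 0)).exists
    exact ⟨_, ht, by rw [Set.mem_setOf_eq, hv]; exact h⟩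

lemma loc1 {ι : Type*} [Fintype ι] (l : ι → V2 →ᵃ[ℝ] ℝ)
    (hne : ∀ i, (l i).linear ≠ 0)
    (hH : ∀ i j, i ≠ j → ∀ x y, l i x = 0 → l j x = 0 → l i y = 0 → l j y = 0 → x = y)
    (U : Set V2) (hUo : IsOpen U) (f : V2 → ℝ) (hf : ContDiffOn ℝ 2 f U) (hpw : PW l U f)
    (x : V2) (hx : x ∈ U) (h1 : ∀ i j, l i x = 0 → l j x = 0 → i = j) :
    ∃ c : ι → ℝ, AnalyticAt ℝ (fun z => f z - ∑ i, c i * tp (l i z)) x := by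
  classical
  obtain ⟨r, hr, hsub, hgood⟩ := good_ball l U hUo x hx
  by_cases hex : ∃ i, l i x = 0
  · obtain ⟨i0, h0⟩ := hex
    have hoth : ∀ i, i ≠ i0 → l i x ≠ 0 := fun i hi h => hi (h1 i i0 h h0)
    obtain ⟨⟨y, hy, hy0⟩, ⟨y', hy', hy0'⟩⟩ := half_nonempty (l i0) (hne i0) x h0 r hr
    have hprod : ∀ i, i ≠ i0 → ∀ z ∈ Metric.ball x r, ∀ w ∈ Metric.ball x r,
        0 < l i z * l i w := by
      intro i hi z hz w hw
      have a := hgood i (hoth i hi) z hz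
      have b := hgood i (hoth i hi) w hw
      have c : 0 < l i x * l i x := mul_self_pos.2 (hoth i hi)
      have d := mul_pos a b
      have : l i z * l i x * (l i w * l i x) = (l i z * l i w) * (l i x * l i x) := by ring
      rw [this] at d
      exact (mul_pos_iff_of_pos_right c).1 d
    have hnz : ∀ w ∈ Metric.ball x r, l i0 w ≠ 0 → ∀ i, l i w ≠ 0 := by
      intro w hw hw0 i
      by_cases hi : i = i0
      · rw [hi]; exact hw0
      · intro h
        have := hprod i hi w hw w hw
        rw [h] at this; simp at this
    obtain ⟨P, hP, hPe⟩ := hpw y (hsub hy) (hnz y hy (ne_of_gt hy0))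
    obtain ⟨Q, hQ, hQe⟩ := hpw y' (hsub hy') (hnz y' hy' (ne_of_lt hy0'))
    refine loc_finish l hne hH x r hr i0 h0 hgood ?_ f (hf.mono hsub) P Q hP hQ 0 0 ?_ ?_
    · intro S hS
      have : S.card ≤ 1 := Finset.card_le_one.2 fun a ha b hb => h1 a b (hS a ha) (hS b hb)
      omega
    · intro z hz
      simp only [Pi.zero_apply, zero_mul, Finset.sum_const_zero, add_zero]
      refine hPe z (hsub hz.1) fun i => ?_
      by_cases hi : i = i0
      · rw [hi]; exact mul_pos hz.2 hy0
      · exact hprod i hi z hz.1 y hy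
    · intro z hz
      simp only [Pi.zero_apply, zero_mul, Finset.sum_const_zero, add_zero]
      refine hQe z (hsub hz.1) fun i => ?_
      by_cases hi : i = i0
      · rw [hi]; exact mul_pos_of_neg_of_neg hz.2 hy0'
      · exact hprod i hi z hz.1 y' hy'
  · push Not at hex
    obtain ⟨P, hP, hPe⟩ := hpw x hx hex
    refine ⟨0, (hP.analyticAt x).congr ?_⟩
    filter_upwards [Metric.ball_mem_nhds x hr] with z hz
    simp only [Pi.zero_apply, zero_mul, Finset.sum_const_zero, sub_zero]
    exact (hPe z (hsub hz) fun i => hgood i (hex i) z hz).symm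

lemma PW.mono {ι : Type*} {l : ι → V2 →ᵃ[ℝ] ℝ} {U W : Set V2} {f : V2 → ℝ} (h : PW l U f)
    (hW : W ⊆ U) : PW l W f := by
  intro x hx hl
  obtain ⟨P, hP, h1⟩ := h x (hW hx) hl
  exact ⟨P, hP, fun z hz => h1 z (hW hz)⟩

theorem arrangement {ι : Type*} [Fintype ι] (l : ι → V2 →ᵃ[ℝ] ℝ)
    (hne : ∀ i, (l i).linear ≠ 0)
    (hH : ∀ i j, i ≠ j → ∀ x y, l i x = 0 → l j x = 0 → l i y = 0 → l j y = 0 → x = y)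
    (U : Set V2) (hUc : Convex ℝ U) (hUo : IsOpen U) (hU : U.Nonempty)
    (hcard : ∀ x ∈ U, ∀ S : Finset ι, (∀ i ∈ S, l i x = 0) → S.card ≤ 4)
    (f : V2 → ℝ) (hf : ContDiffOn ℝ 2 f U) (hpw : PW l U f) :
    ∃ (c : ι → ℝ) (P : V2 → ℝ), Cub P ∧ ∀ z ∈ U, f z = P z + ∑ i, c i * tp (l i z) := by
  refine global_form l hne hH U hUc hUo hU f hpw fun x hx => ?_
  by_cases hex : ∃ i, l i x = 0
  swap
  · push Not at hex
    exact loc1 l hne hH U hUo f hf hpw x hx fun i j h _ => absurd h (hex i)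
  obtain ⟨i0, h0⟩ := hex
  obtain ⟨r, hr, hsub, hgood⟩ := good_ball l U hUo x hx
  obtain ⟨hne1, hne2⟩ := half_nonempty (l i0) (hne i0) x h0 r hr
  have hone : ∀ w ∈ Metric.ball x r, l i0 w ≠ 0 → ∀ i j, l i w = 0 → l j w = 0 → i = j := by
    intro w hw hw0 i j hi hj
    by_contra hij
    have hz : ∀ i, l i w = 0 → l i x = 0 := by
      intro i hi
      by_contra h
      have := hgood i h w hw
      rw [hi] at this; simp at this
    have := hH i j hij w x hi hj (hz i hi) (hz j hj)
    rw [this] at hw0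
    exact hw0 h0
  have hopen1 : IsOpen (Metric.ball x r ∩ {z | 0 < l i0 z}) :=
    Metric.isOpen_ball.inter (isOpen_lt continuous_const (aff_cont _))
  have hopen2 : IsOpen (Metric.ball x r ∩ {z | l i0 z < 0}) :=
    Metric.isOpen_ball.inter (isOpen_lt (aff_cont _) continuous_const)
  have hconv1 : Convex ℝ (Metric.ball x r ∩ {z | 0 < l i0 z}) :=
    (convex_ball x r).inter ((convex_Ioi (0 : ℝ)).affine_preimage (l i0))
  have hconv2 : Convex ℝ (Metric.ball x r ∩ {z | l i0 z < 0}) :=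
    (convex_ball x r).inter ((convex_Iio (0 : ℝ)).affine_preimage (l i0))
  have hs1 : Metric.ball x r ∩ {z | 0 < l i0 z} ⊆ U := fun z hz => hsub hz.1
  have hs2 : Metric.ball x r ∩ {z | l i0 z < 0} ⊆ U := fun z hz => hsub hz.1
  obtain ⟨j, P, hP, hPe⟩ := global_form l hne hH _ hconv1 hopen1 hne1 f (hpw.mono hs1)
    fun y hy => loc1 l hne hH _ hopen1 f (hf.mono hs1) (hpw.mono hs1) y hy
      (hone y hy.1 (ne_of_gt hy.2))
  obtain ⟨j', Q, hQ, hQe⟩ := global_form l hne hH _ hconv2 hopen2 hne2 f (hpw.mono hs2)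
    fun y hy => loc1 l hne hH _ hopen2 f (hf.mono hs2) (hpw.mono hs2) y hy
      (hone y hy.1 (ne_of_lt hy.2))
  exact loc_finish l hne hH x r hr i0 h0 hgood (hcard x hx) f (hf.mono hsub) P Q hP hQ j j'
    hPe hQe

/-! ### The concrete arrangement -/

/-- Coefficients (in barycentric coordinates) of the 18 interior lines. -/
def lineTab : Fin 18 → Fin 3 → ℤ :=
  ![![2, -1, 0], ![1, -2, 0], ![2, 2, -1], ![4, -2, 1], ![1, 4, -2], ![1, -2, 1],
    ![0, 2, -1], ![4, 1, -2], ![2, -1, 2], ![1, 1, -2], ![1, -2, 4], ![0, 1, -2],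
    ![2, 0, -1], ![1, 0, -2], ![2, -1, -1], ![2, -4, -1], ![2, -1, -4], ![1, -2, -2]]

/-- Three times the barycentric coordinates of the nine boundary points. -/
def ptTab : Fin 9 → Fin 3 → ℤ :=
  ![![3, 0, 0], ![0, 3, 0], ![0, 0, 3], ![2, 1, 0], ![1, 2, 0], ![2, 0, 1], ![1, 0, 2],
    ![0, 2, 1], ![0, 1, 2]]

/-- Integer dot product. -/
def zdot (a b : Fin 3 → ℤ) : ℤ := a 0 * b 0 + a 1 * b 1 + a 2 * b 2

/-- Integer cross product. -/
def zcr (a b : Fin 3 → ℤ) : Fin 3 → ℤ :=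
  ![a 1 * b 2 - a 2 * b 1, a 2 * b 0 - a 0 * b 2, a 0 * b 1 - a 1 * b 0]

lemma tab_nonconst : ∀ m, ¬ (lineTab m 0 = lineTab m 1 ∧ lineTab m 1 = lineTab m 2) := by
  decide +kernel

lemma tab_cross : ∀ i j, i ≠ j → zcr (lineTab i) (lineTab j) ≠ 0 := by
  decide +kernel

lemma tab_conc : ∀ i j, i ≠ j →
    ((∀ k, 0 < zcr (lineTab i) (lineTab j) k) ∨ (∀ k, zcr (lineTab i) (lineTab j) k < 0)) →
    (Finset.univ.filter fun m => zdot (lineTab m) (zcr (lineTab i) (lineTab j)) = 0).card ≤ 4 := by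
  decide +kernel

lemma tab_pairs : ∀ n n' : Fin 9, n = n' ∨ (zcr (ptTab n) (ptTab n') ≠ 0 ∧
    ((∃ m, zcr (zcr (ptTab n) (ptTab n')) (lineTab m) = 0) ∨
      ∃ k : Fin 3, ∀ k', k' ≠ k → zcr (ptTab n) (ptTab n') k' = 0)) := by
  decide +kernel

lemma tab_line : ∀ m, ∃ n n' : Fin 9, zcr (ptTab n) (ptTab n') ≠ 0 ∧
    zcr (zcr (ptTab n) (ptTab n')) (lineTab m) = 0 := by
  decide +kernel

lemma tab_pts : ∀ i j : Fin 3, ∀ k : Fin 4, ∃ n, ∀ t : Fin 3, ptTab n t =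
    (if t = i then (k : ℕ) else 0 : ℤ) + (if t = j then 3 - (k : ℕ) else 0 : ℤ) := by
  decide +kernel

lemma tab_pts' : ∀ n, ∃ i j : Fin 3, ∃ k : Fin 4, ∀ t : Fin 3, ptTab n t =
    (if t = i then (k : ℕ) else 0 : ℤ) + (if t = j then 3 - (k : ℕ) else 0 : ℤ) := by
  decide +kernel

lemma tab_sum : ∀ n, ptTab n 0 + ptTab n 1 + ptTab n 2 = 3 := by
  decide +kernel

/-- The affine basis given by the vertices. -/
noncomputable def tb (p : Fin 3 → V2) (hp : AffineIndependent ℝ p) : AffineBasis (Fin 3) ℝ V2 :=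
  ⟨p, hp, (hp.affineSpan_eq_top_iff_card_eq_finrank_add_one).2 (by simp)⟩

lemma tb_apply (p : Fin 3 → V2) (hp : AffineIndependent ℝ p) (k : Fin 3) : tb p hp k = p k := rfl

lemma tb_sum (p : Fin 3 → V2) (hp : AffineIndependent ℝ p) (z : V2) :
    (tb p hp).coord 0 z + (tb p hp).coord 1 z + (tb p hp).coord 2 z = 1 := by
  have := (tb p hp).sum_coord_apply_eq_one z
  rwa [Fin.sum_univ_three] at this

lemma tb_self (p : Fin 3 → V2) (hp : AffineIndependent ℝ p) (z : V2) :
    z = (tb p hp).coord 0 z • p 0 + (tb p hp).coord 1 z • p 1 + (tb p hp).coord 2 z • p 2 := by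
  have := (tb p hp).linear_combination_coord_eq_self z
  rw [Fin.sum_univ_three] at this
  exact this.symm

lemma tb_ext (p : Fin 3 → V2) (hp : AffineIndependent ℝ p) (z w : V2)
    (h : ∀ k, (tb p hp).coord k z = (tb p hp).coord k w) : z = w := by
  rw [tb_self p hp z, tb_self p hp w, h, h, h]

lemma tb_coord (p : Fin 3 → V2) (hp : AffineIndependent ℝ p) (w : Fin 3 → ℝ)
    (hw : w 0 + w 1 + w 2 = 1) (k : Fin 3) :
    (tb p hp).coord k (w 0 • p 0 + w 1 • p 1 + w 2 • p 2) = w k := by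
  have h1 : ∑ i, w i = 1 := by rw [Fin.sum_univ_three]; exact hw
  have h2 := (tb p hp).coord_apply_combination_of_mem (Finset.mem_univ k) h1
  rw [Finset.affineCombination_eq_linear_combination _ _ _ h1, Fin.sum_univ_three] at h2
  exact h2

/-- The affine function with given barycentric coefficients. -/
noncomputable def lam (p : Fin 3 → V2) (hp : AffineIndependent ℝ p) (a : Fin 3 → ℤ) :
    V2 →ᵃ[ℝ] ℝ :=
  (a 0 : ℝ) • (tb p hp).coord 0 + (a 1 : ℝ) • (tb p hp).coord 1 + (a 2 : ℝ) • (tb p hp).coord 2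

lemma lam_apply (p : Fin 3 → V2) (hp : AffineIndependent ℝ p) (a : Fin 3 → ℤ) (z : V2) :
    lam p hp a z = a 0 * (tb p hp).coord 0 z + a 1 * (tb p hp).coord 1 z
      + a 2 * (tb p hp).coord 2 z := by
  simp [lam]

lemma lam_ne (p : Fin 3 → V2) (hp : AffineIndependent ℝ p) (m : Fin 18) :
    (lam p hp (lineTab m)).linear ≠ 0 := by
  intro h
  have hc : ∀ k, lam p hp (lineTab m) (p k) = lineTab m k := by
    intro k
    rw [lam_apply]
    have e : ∀ j, (tb p hp).coord j (p k) = if j = k then 1 else 0 := fun j =>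
      (tb p hp).coord_apply j k
    simp only [e]
    fin_cases k <;> simp
  have hq : ∀ k k', (lineTab m k : ℝ) = lineTab m k' := by
    intro k k'
    rw [← hc, ← hc]
    have := aff_add (lam p hp (lineTab m)) (p k) (p k' - p k)
    rw [h] at this
    simpa using this.symm
  exact tab_nonconst m ⟨by exact_mod_cast hq 0 1, by exact_mod_cast hq 1 2⟩

lemma zcr_ne {c : Fin 3 → ℤ} (h : c ≠ 0) : ∃ k, c k ≠ 0 := by
  by_contra hc
  push Not at hc
  exact h (funext hc)

/-- A point on two lines has barycentric coordinates proportional to the cross product. -/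
lemma cross_coord (p : Fin 3 → V2) (hp : AffineIndependent ℝ p) (a a' : Fin 3 → ℤ) (z : V2)
    (h : lam p hp a z = 0) (h' : lam p hp a' z = 0) (k : Fin 3) :
    (zcr a a' k : ℝ) = (tb p hp).coord k z * (zcr a a' 0 + zcr a a' 1 + zcr a a' 2) := by
  rw [lam_apply] at h h'
  have hs := tb_sum p hp z
  set x := (tb p hp).coord 0 z
  set y := (tb p hp).coord 1 z
  set w := (tb p hp).coord 2 z
  fin_cases k
  · change ((a 1 * a' 2 - a 2 * a' 1 : ℤ) : ℝ) = x * ((a 1 * a' 2 - a 2 * a' 1 : ℤ)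
      + (a 2 * a' 0 - a 0 * a' 2 : ℤ) + (a 0 * a' 1 - a 1 * a' 0 : ℤ))
    push_cast
    linear_combination (-(a 1 * a' 2 - a 2 * a' 1 : ℝ)) * hs + (a' 2 - a' 1 : ℝ) * h
      - (a 2 - a 1 : ℝ) * h'
  · change ((a 2 * a' 0 - a 0 * a' 2 : ℤ) : ℝ) = y * ((a 1 * a' 2 - a 2 * a' 1 : ℤ)
      + (a 2 * a' 0 - a 0 * a' 2 : ℤ) + (a 0 * a' 1 - a 1 * a' 0 : ℤ))
    push_cast
    linear_combination (-(a 2 * a' 0 - a 0 * a' 2 : ℝ)) * hs + (a' 0 - a' 2 : ℝ) * h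
      - (a 0 - a 2 : ℝ) * h'
  · change ((a 0 * a' 1 - a 1 * a' 0 : ℤ) : ℝ) = w * ((a 1 * a' 2 - a 2 * a' 1 : ℤ)
      + (a 2 * a' 0 - a 0 * a' 2 : ℤ) + (a 0 * a' 1 - a 1 * a' 0 : ℤ))
    push_cast
    linear_combination (-(a 0 * a' 1 - a 1 * a' 0 : ℝ)) * hs + (a' 1 - a' 0 : ℝ) * h
      - (a 1 - a 0 : ℝ) * h'

lemma cross_sum_ne (p : Fin 3 → V2) (hp : AffineIndependent ℝ p) (i j : Fin 18) (hij : i ≠ j)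
    (z : V2) (h : lam p hp (lineTab i) z = 0) (h' : lam p hp (lineTab j) z = 0) :
    (zcr (lineTab i) (lineTab j) 0 + zcr (lineTab i) (lineTab j) 1
      + zcr (lineTab i) (lineTab j) 2 : ℝ) ≠ 0 := by
  intro h0
  obtain ⟨k, hk⟩ := zcr_ne (tab_cross i j hij)
  have := cross_coord p hp _ _ z h h' k
  rw [h0, mul_zero] at this
  exact hk (by exact_mod_cast this)

lemma lam_hH (p : Fin 3 → V2) (hp : AffineIndependent ℝ p) (i j : Fin 18) (hij : i ≠ j)
    (x y : V2) (h1 : lam p hp (lineTab i) x = 0) (h2 : lam p hp (lineTab j) x = 0)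
    (h3 : lam p hp (lineTab i) y = 0) (h4 : lam p hp (lineTab j) y = 0) : x = y := by
  refine tb_ext p hp x y fun k => ?_
  have a := cross_coord p hp _ _ x h1 h2 k
  have b := cross_coord p hp _ _ y h3 h4 k
  exact mul_right_cancel₀ (cross_sum_ne p hp i j hij x h1 h2) (a.symm.trans b)

lemma tri_interior (p : Fin 3 → V2) (hp : AffineIndependent ℝ p) :
    interior (tri p) = {z | ∀ k, 0 < (tb p hp).coord k z} :=
  (tb p hp).interior_convexHull

lemma tri_eq (p : Fin 3 → V2) (hp : AffineIndependent ℝ p) :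
    tri p = {z | ∀ k, 0 ≤ (tb p hp).coord k z} :=
  (tb p hp).convexHull_eq_nonneg_coord

lemma lam_card (p : Fin 3 → V2) (hp : AffineIndependent ℝ p) (x : V2)
    (hx : x ∈ interior (tri p)) (S : Finset (Fin 18))
    (hS : ∀ i ∈ S, lam p hp (lineTab i) x = 0) : S.card ≤ 4 := by
  rw [tri_interior p hp] at hx
  by_cases h1 : S.card ≤ 1
  · omega
  obtain ⟨i, hi, j, hj, hij⟩ := Finset.one_lt_card.1 (not_le.1 h1)
  have hne := cross_sum_ne p hp i j hij x (hS i hi) (hS j hj)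
  have hc := cross_coord p hp _ _ x (hS i hi) (hS j hj)
  set c := zcr (lineTab i) (lineTab j) with hcdef
  refine (Finset.card_le_card ?_).trans (tab_conc i j hij ?_)
  · intro m hm
    rw [Finset.mem_filter]
    refine ⟨Finset.mem_univ _, ?_⟩
    have h := hS m hm
    rw [lam_apply] at h
    have : ((zdot (lineTab m) c : ℤ) : ℝ) = 0 := by
      unfold zdot
      push_cast
      linear_combination (lineTab m 0 : ℝ) * hc 0 + (lineTab m 1 : ℝ) * hc 1
        + (lineTab m 2 : ℝ) * hc 2 + (c 0 + c 1 + c 2 : ℝ) * h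
    exact_mod_cast this
  · rcases lt_or_gt_of_ne hne with h | h
    · right
      intro k
      have : (c k : ℝ) < 0 := by rw [hc k]; exact mul_neg_of_pos_of_neg (hx k) h
      exact_mod_cast this
    · left
      intro k
      have : (0 : ℝ) < c k := by rw [hc k]; exact mul_pos (hx k) h
      exact_mod_cast this

/-- The boundary point with index `n`. -/
noncomputable def bpt (p : Fin 3 → V2) (n : Fin 9) : V2 :=
  ((ptTab n 0 : ℝ) / 3) • p 0 + ((ptTab n 1 : ℝ) / 3) • p 1 + ((ptTab n 2 : ℝ) / 3) • p 2

lemma bpt_coord (p : Fin 3 → V2) (hp : AffineIndependent ℝ p) (n : Fin 9) (k : Fin 3) :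
    (tb p hp).coord k (bpt p n) = (ptTab n k : ℝ) / 3 := by
  refine tb_coord p hp (fun k => (ptTab n k : ℝ) / 3) ?_ k
  have : ((ptTab n 0 + ptTab n 1 + ptTab n 2 : ℤ) : ℝ) = (3 : ℤ) := by rw [tab_sum n]
  push_cast at this
  linarith

lemma bpt_eq (p : Fin 3 → V2) (n : Fin 9) (i j : Fin 3) (k : Fin 4) (h : ∀ t : Fin 3, ptTab n t =
    (if t = i then (k : ℕ) else 0 : ℤ) + (if t = j then 3 - (k : ℕ) else 0 : ℤ)) :
    bpt p n = ((k : ℝ) / 3) • p i + (1 - (k : ℝ) / 3) • p j := by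
  have e : ∀ t, (ptTab n t : ℝ) / 3
      = (if t = i then (k : ℝ) / 3 else 0) + (if t = j then 1 - (k : ℝ) / 3 else 0) := by
    intro t
    rw [h t]
    push_cast
    split_ifs <;> ring
  have f : ∀ (i : Fin 3) (c : ℝ), c • p i = ∑ t, (if t = i then c else 0) • p t := by
    intro i c; simp
  rw [f i, f j, ← Finset.sum_add_distrib, Fin.sum_univ_three]
  simp only [← add_smul, ← e]
  rfl

lemma wsPts_eq (p : Fin 3 → V2) : wsPts p = Set.range (bpt p) := by
  ext x
  constructor
  · rintro ⟨i, j, k, rfl⟩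
    obtain ⟨n, hn⟩ := tab_pts i j k
    exact ⟨n, bpt_eq p n i j k hn⟩
  · rintro ⟨n, rfl⟩
    obtain ⟨i, j, k, h⟩ := tab_pts' n
    exact ⟨i, j, k, bpt_eq p n i j k h⟩

lemma para (c d : Fin 3 → ℤ) (hc : c ≠ 0) (h : zcr c d = 0) (x : Fin 3 → ℝ)
    (h0 : (c 0 : ℝ) * x 0 + c 1 * x 1 + c 2 * x 2 = 0) :
    (d 0 : ℝ) * x 0 + d 1 * x 1 + d 2 * x 2 = 0 := by
  have e0 : c 1 * d 2 - c 2 * d 1 = 0 := congrFun h 0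
  have e1 : c 2 * d 0 - c 0 * d 2 = 0 := congrFun h 1
  have e2 : c 0 * d 1 - c 1 * d 0 = 0 := congrFun h 2
  have f0 : (c 1 * d 2 - c 2 * d 1 : ℝ) = 0 := by exact_mod_cast e0
  have f1 : (c 2 * d 0 - c 0 * d 2 : ℝ) = 0 := by exact_mod_cast e1
  have f2 : (c 0 * d 1 - c 1 * d 0 : ℝ) = 0 := by exact_mod_cast e2
  obtain ⟨k, hk⟩ := zcr_ne hc
  have hk' : (c k : ℝ) ≠ 0 := by exact_mod_cast hk
  refine (mul_eq_zero.1 (?_ : (c k : ℝ) * _ = 0)).resolve_left hk'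
  fin_cases k
  · change (c 0 : ℝ) * _ = 0
    linear_combination d 0 * h0 + x 1 * f2 - x 2 * f1
  · change (c 1 : ℝ) * _ = 0
    linear_combination d 1 * h0 - x 0 * f2 + x 2 * f0
  · change (c 2 : ℝ) * _ = 0
    linear_combination d 2 * h0 + x 0 * f1 - x 1 * f0

lemma mem_line_iff (a b z : V2) : z ∈ line[ℝ, a, b] ↔ ∃ r : ℝ, AffineMap.lineMap a b r = z := by
  constructor
  · intro h
    have h' : (z - a) +ᵥ a ∈ line[ℝ, a, b] := by simpa using h
    obtain ⟨r, hr⟩ := vadd_left_mem_affineSpan_pair.1 h'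
    refine ⟨r, ?_⟩
    rw [AffineMap.lineMap_apply, hr]
    simp
  · rintro ⟨r, rfl⟩
    exact AffineMap.lineMap_mem_affineSpan_pair r a b

lemma cut_sub (p : Fin 3 → V2) (hp : AffineIndependent ℝ p) (z : V2)
    (hz : z ∈ interior (tri p)) (hc : z ∈ cutLines p) :
    ∃ m, lam p hp (lineTab m) z = 0 := by
  rw [tri_interior p hp] at hz
  obtain ⟨a, ha, b, hb, hab, hzab⟩ := hc
  rw [wsPts_eq] at ha hb
  obtain ⟨n, rfl⟩ := ha
  obtain ⟨n', rfl⟩ := hb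
  rw [SetLike.mem_coe, mem_line_iff] at hzab
  obtain ⟨r, rfl⟩ := hzab
  have hco : ∀ k, (tb p hp).coord k (AffineMap.lineMap (bpt p n) (bpt p n') r)
      = (1 - r) * (ptTab n k / 3) + r * (ptTab n' k / 3) := by
    intro k
    rw [AffineMap.apply_lineMap, AffineMap.lineMap_apply_module, bpt_coord, bpt_coord]
    rfl
  set z := AffineMap.lineMap (bpt p n) (bpt p n') r
  set c := zcr (ptTab n) (ptTab n') with hcd
  have h0 : (c 0 : ℝ) * (tb p hp).coord 0 z + c 1 * (tb p hp).coord 1 z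
      + c 2 * (tb p hp).coord 2 z = 0 := by
    rw [hco, hco, hco]
    have e0 : c 0 = ptTab n 1 * ptTab n' 2 - ptTab n 2 * ptTab n' 1 := rfl
    have e1 : c 1 = ptTab n 2 * ptTab n' 0 - ptTab n 0 * ptTab n' 2 := rfl
    have e2 : c 2 = ptTab n 0 * ptTab n' 1 - ptTab n 1 * ptTab n' 0 := rfl
    rw [e0, e1, e2]
    push_cast
    ring
  rcases tab_pairs n n' with h | ⟨hne, ⟨m, hm⟩ | ⟨k, hk⟩⟩
  · exact absurd (by rw [h]) hab
  · refine ⟨m, ?_⟩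
    rw [lam_apply]
    exact para c _ hne hm (fun k => (tb p hp).coord k z) h0
  · exfalso
    have hck : c k ≠ 0 := by
      intro h
      apply hne
      funext k'
      by_cases hkk : k' = k
      · rw [hkk]; exact h
      · exact hk k' hkk
    have hs : ∑ k', (c k' : ℝ) * (tb p hp).coord k' z = 0 := by
      rw [Fin.sum_univ_three]; exact h0
    rw [Finset.sum_eq_single_of_mem k (Finset.mem_univ k)] at hs
    · rcases mul_eq_zero.1 hs with h | h
      · exact hck (by exact_mod_cast h)
      · exact (hz k).ne' h
    · intro k' _ hkk
      have : c k' = 0 := hk k' hkk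
      rw [this]; simp

lemma det_comb (A0 A1 A2 B0 B1 B2 x y z : ℝ) (hc : A0 * B1 - A1 * B0 ≠ 0)
    (h : (A1 * B2 - A2 * B1) * x + (A2 * B0 - A0 * B2) * y + (A0 * B1 - A1 * B0) * z = 0) :
    ∃ s t, x = s * A0 + t * B0 ∧ y = s * A1 + t * B1 ∧ z = s * A2 + t * B2 := by
  have hi := mul_inv_cancel₀ hc
  set i := (A0 * B1 - A1 * B0)⁻¹
  refine ⟨(x * B1 - y * B0) * i, (A0 * y - A1 * x) * i, ?_, ?_, ?_⟩
  · linear_combination (-x) * hi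
  · linear_combination (-y) * hi
  · linear_combination (-z) * hi + i * h

lemma cut_sup (p : Fin 3 → V2) (hp : AffineIndependent ℝ p) (z : V2) (m : Fin 18)
    (hm : lam p hp (lineTab m) z = 0) : z ∈ cutLines p := by
  obtain ⟨n, n', hne, hpar⟩ := tab_line m
  set c := zcr (ptTab n) (ptTab n') with hcd
  have e0 : c 0 = ptTab n 1 * ptTab n' 2 - ptTab n 2 * ptTab n' 1 := rfl
  have e1 : c 1 = ptTab n 2 * ptTab n' 0 - ptTab n 0 * ptTab n' 2 := rfl
  have e2 : c 2 = ptTab n 0 * ptTab n' 1 - ptTab n 1 * ptTab n' 0 := rfl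
  have hpar' : zcr (lineTab m) c = 0 := by
    have f0 : c 1 * lineTab m 2 - c 2 * lineTab m 1 = 0 := congrFun hpar 0
    have f1 : c 2 * lineTab m 0 - c 0 * lineTab m 2 = 0 := congrFun hpar 1
    have f2 : c 0 * lineTab m 1 - c 1 * lineTab m 0 = 0 := congrFun hpar 2
    funext k
    fin_cases k
    · change lineTab m 1 * c 2 - lineTab m 2 * c 1 = 0
      linear_combination -f0
    · change lineTab m 2 * c 0 - lineTab m 0 * c 2 = 0
      linear_combination -f1
    · change lineTab m 0 * c 1 - lineTab m 1 * c 0 = 0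
      linear_combination -f2
  have hm0 : lineTab m ≠ 0 := by
    intro h
    exact tab_nonconst m (by rw [h]; simp)
  rw [lam_apply] at hm
  have h0 := para _ c hm0 hpar' (fun k => (tb p hp).coord k z) hm
  have hs := tb_sum p hp z
  rw [e0, e1, e2] at h0
  push_cast at h0
  have hex : ∃ s t : ℝ, ∀ k, (tb p hp).coord k z = s * ptTab n k + t * ptTab n' k := by
    obtain ⟨k, hk⟩ := zcr_ne hne
    fin_cases k
    · have hk' : (ptTab n 1 * ptTab n' 2 - ptTab n 2 * ptTab n' 1 : ℝ) ≠ 0 := by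
        exact_mod_cast hk
      obtain ⟨s, t, h1, h2, h3⟩ := det_comb _ _ (ptTab n 0) _ _ (ptTab n' 0)
        ((tb p hp).coord 1 z) ((tb p hp).coord 2 z) ((tb p hp).coord 0 z) hk'
        (by linear_combination h0)
      refine ⟨s, t, fun k => ?_⟩
      fin_cases k
      exacts [h3, h1, h2]
    · have hk' : (ptTab n 2 * ptTab n' 0 - ptTab n 0 * ptTab n' 2 : ℝ) ≠ 0 := by
        exact_mod_cast hk
      obtain ⟨s, t, h1, h2, h3⟩ := det_comb _ _ (ptTab n 1) _ _ (ptTab n' 1)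
        ((tb p hp).coord 2 z) ((tb p hp).coord 0 z) ((tb p hp).coord 1 z) hk'
        (by linear_combination h0)
      refine ⟨s, t, fun k => ?_⟩
      fin_cases k
      exacts [h2, h3, h1]
    · have hk' : (ptTab n 0 * ptTab n' 1 - ptTab n 1 * ptTab n' 0 : ℝ) ≠ 0 := by
        exact_mod_cast hk
      obtain ⟨s, t, h1, h2, h3⟩ := det_comb _ _ (ptTab n 2) _ _ (ptTab n' 2)
        ((tb p hp).coord 0 z) ((tb p hp).coord 1 z) ((tb p hp).coord 2 z) hk'
        (by linear_combination h0)
      refine ⟨s, t, fun k => ?_⟩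
      fin_cases k
      exacts [h1, h2, h3]
  obtain ⟨s, t, hst⟩ := hex
  have s1 : ((ptTab n 0 : ℝ) + ptTab n 1 + ptTab n 2) = 3 := by exact_mod_cast tab_sum n
  have s2 : ((ptTab n' 0 : ℝ) + ptTab n' 1 + ptTab n' 2) = 3 := by exact_mod_cast tab_sum n'
  have hst1 : 3 * s = 1 - 3 * t := by
    rw [hst, hst, hst] at hs
    linear_combination hs - s * s1 - t * s2
  refine ⟨bpt p n, by rw [wsPts_eq]; exact ⟨n, rfl⟩, bpt p n', by rw [wsPts_eq]; exact ⟨n', rfl⟩,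
    ?_, ?_⟩
  · intro h
    have hk : ∀ k, ptTab n k = ptTab n' k := by
      intro k
      have h1 := bpt_coord p hp n k
      rw [h, bpt_coord] at h1
      have : (ptTab n k : ℝ) = ptTab n' k := by linarith
      exact_mod_cast this
    obtain ⟨k, hk0⟩ := zcr_ne hne
    apply hk0
    fin_cases k
    · change c 0 = 0
      rw [e0, hk, hk]; ring
    · change c 1 = 0
      rw [e1, hk, hk]; ring
    · change c 2 = 0
      rw [e2, hk, hk]; ring
  · rw [SetLike.mem_coe, mem_line_iff]
    refine ⟨3 * t, tb_ext p hp _ _ fun k => ?_⟩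
    rw [AffineMap.apply_lineMap, AffineMap.lineMap_apply_module, bpt_coord, bpt_coord, hst k]
    simp only [smul_eq_mul]
    linear_combination (-(ptTab n k : ℝ) / 3) * hst1

/-! ### Parametrization of the spline space -/

/-- Barycentric coefficients of ten linear forms whose cubes span the cubic polynomials. -/
def formTab : Fin 10 → Fin 3 → ℤ :=
  ![![1, 0, 0], ![0, 1, 0], ![0, 0, 1], ![1, 1, 0], ![1, -1, 0], ![1, 0, 1], ![1, 0, -1],
    ![0, 1, 1], ![0, 1, -1], ![1, 1, 1]]

/-- The spline with given coefficients. -/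
noncomputable def spl (p : Fin 3 → V2) (hp : AffineIndependent ℝ p) (d : Fin 10 → ℝ)
    (c : Fin 18 → ℝ) (z : V2) : ℝ :=
  ∑ i, d i * lam p hp (formTab i) z ^ 3 + ∑ m, c m * tp (lam p hp (lineTab m) z)

lemma aff_contDiff (l : V2 →ᵃ[ℝ] ℝ) : ContDiff ℝ 2 fun z => l z := by
  have : (fun z => l z) = fun z => LinearMap.toContinuousLinearMap l.linear z + l 0 :=
    funext fun z => aff_eq l z
  rw [this]
  fun_prop

lemma spl_contDiff (p : Fin 3 → V2) (hp : AffineIndependent ℝ p) (d : Fin 10 → ℝ)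
    (c : Fin 18 → ℝ) : ContDiff ℝ 2 (spl p hp d c) := by
  unfold spl
  refine ContDiff.add (ContDiff.sum fun i _ => ?_) (ContDiff.sum fun i _ => ?_)
  · exact contDiff_const.mul ((aff_contDiff _).pow 3)
  · exact contDiff_const.mul (contDiff_tp.comp (aff_contDiff _))

lemma cubes_span (a : Fin 10 → ℝ) : ∃ d : Fin 10 → ℝ, ∀ x y z : ℝ, x + y + z = 1 →
    cubEval a y z = d 0 * x ^ 3 + d 1 * y ^ 3 + d 2 * z ^ 3 + d 3 * (x + y) ^ 3
      + d 4 * (x - y) ^ 3 + d 5 * (x + z) ^ 3 + d 6 * (x - z) ^ 3 + d 7 * (y + z) ^ 3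
      + d 8 * (y - z) ^ 3 + d 9 * (x + y + z) ^ 3 := by
  obtain ⟨g, hg⟩ : ∃ g, g = (6 * a 0 + 2 * a 1 + 2 * a 2 + a 4) / 6 := ⟨_, rfl⟩
  obtain ⟨A, hA⟩ : ∃ g', g' = 3 * a 0 + a 1 - 3 * g := ⟨_, rfl⟩
  obtain ⟨B, hB⟩ : ∃ g', g' = 3 * a 0 + 2 * a 1 + a 3 - 3 * g := ⟨_, rfl⟩
  obtain ⟨C, hC⟩ : ∃ g', g' = 3 * a 0 + a 2 - 3 * g := ⟨_, rfl⟩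
  obtain ⟨D, hD⟩ : ∃ g', g' = 3 * a 0 + 2 * a 2 + a 5 - 3 * g := ⟨_, rfl⟩
  obtain ⟨E, hE⟩ : ∃ g', g' = 3 * a 0 + 2 * a 1 + a 2 + a 3 + a 4 + a 7 - 3 * g := ⟨_, rfl⟩
  obtain ⟨F, hF⟩ : ∃ g', g' = 3 * a 0 + a 1 + 2 * a 2 + a 4 + a 5 + a 8 - 3 * g := ⟨_, rfl⟩
  refine ⟨![a 0 - g - B / 3 - D / 3, a 0 + a 1 + a 3 + a 6 - g - A / 3 - F / 3,
    a 0 + a 2 + a 5 + a 9 - g - C / 3 - E / 3, (A + B) / 6, (B - A) / 6, (C + D) / 6, (D - C) / 6,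
    (E + F) / 6, (F - E) / 6, g], fun x y z h => ?_⟩
  obtain rfl : x = 1 - y - z := by linarith
  simp only [Matrix.cons_val]
  unfold cubEval
  subst hA hB hC hD hE hF hg
  ring

lemma Cub.to_spl (p : Fin 3 → V2) (hp : AffineIndependent ℝ p) {P : V2 → ℝ} (hP : Cub P) :
    ∃ d : Fin 10 → ℝ, ∀ z, P z = ∑ i, d i * lam p hp (formTab i) z ^ 3 := by
  obtain ⟨a, ha⟩ := hP (p 0) (p 1 - p 0) (p 2 - p 0)
  obtain ⟨d, hd⟩ := cubes_span a
  refine ⟨d, fun z => ?_⟩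
  have hs := tb_sum p hp z
  have hz : z = p 0 + (tb p hp).coord 1 z • (p 1 - p 0) + (tb p hp).coord 2 z • (p 2 - p 0) := by
    conv_lhs => rw [tb_self p hp z]
    have : (tb p hp).coord 0 z = 1 - (tb p hp).coord 1 z - (tb p hp).coord 2 z := by linarith
    rw [this]
    module
  conv_lhs => rw [hz, ha, hd _ _ _ hs]
  simp only [Fin.sum_univ_succ, Fin.sum_univ_zero, lam_apply, formTab, Matrix.cons_val]
  simp [Fin.succ_one_eq_two]
  ring

lemma tri_convex (p : Fin 3 → V2) : Convex ℝ (tri p) := convex_convexHull ℝ _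

lemma tri_closed (p : Fin 3 → V2) : IsClosed (tri p) :=
  ((Set.finite_range p).isCompact_convexHull (𝕜 := ℝ)).isClosed

lemma bctr_mem (p : Fin 3 → V2) (hp : AffineIndependent ℝ p) : bctr p ∈ interior (tri p) := by
  rw [tri_interior p hp]
  intro k
  have := tb_coord p hp (fun _ => 1 / 3) (by norm_num) k
  have h2 : (tb p hp).coord k (bctr p) = 1 / 3 := this
  rw [h2]; norm_num

theorem spline_form (p : Fin 3 → V2) (hp : AffineIndependent ℝ p) (f : V2 → ℝ)
    (hf : ContDiffOn ℝ 2 f (tri p))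
    (hpoly : ∀ x ∈ interior (tri p) \ cutLines p,
      ∃ g, IsPolyDeg 3 g ∧
        Set.EqOn f g (connectedComponentIn (interior (tri p) \ cutLines p) x)) :
    ∃ d c, ∀ z ∈ tri p, f z = spl p hp d c z := by
  have hne : (interior (tri p)).Nonempty := ⟨_, bctr_mem p hp⟩
  have hpw : PW (fun m => lam p hp (lineTab m)) (interior (tri p)) f := by
    intro x hx hl
    have hxc : x ∈ interior (tri p) \ cutLines p :=
      ⟨hx, fun h => by obtain ⟨m, hm⟩ := cut_sub p hp x hx h; exact hl m hm⟩
    obtain ⟨g, hg, hfg⟩ := hpoly x hxc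
    refine ⟨g, hg.cub, fun z hz hzl => hfg ?_⟩
    let cell : Set V2 := interior (tri p) ∩
      ⋂ m, {z | 0 < lam p hp (lineTab m) z * lam p hp (lineTab m) x}
    have hconv : Convex ℝ cell := by
      refine (tri_convex p).interior.inter (convex_iInter fun m => ?_)
      have h : {z | 0 < lam p hp (lineTab m) z * lam p hp (lineTab m) x}
          = (lam p hp (lineTab m) x • lam p hp (lineTab m)) ⁻¹' Set.Ioi 0 := by
        ext z
        simp [mul_comm]
      rw [h]
      exact (convex_Ioi (0 : ℝ)).affine_preimage _
    have hsub : cell ⊆ interior (tri p) \ cutLines p := by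
      intro w hw
      refine ⟨hw.1, fun h => ?_⟩
      obtain ⟨m, hm⟩ := cut_sub p hp w hw.1 h
      have := Set.mem_iInter.1 hw.2 m
      simp only [Set.mem_ofPred_eq, hm, zero_mul, lt_irrefl] at this
    have hxcell : x ∈ cell := ⟨hx, Set.mem_iInter.2 fun m => mul_self_pos.2 (hl m)⟩
    exact hconv.isPreconnected.subset_connectedComponentIn hxcell hsub
      ⟨hz, Set.mem_iInter.2 hzl⟩
  obtain ⟨c, P, hP, hform⟩ := arrangement (fun m => lam p hp (lineTab m)) (lam_ne p hp)
    (fun i j hij x y => lam_hH p hp i j hij x y) (interior (tri p)) (tri_convex p).interior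
    isOpen_interior hne (fun x hx S hS => lam_card p hp x hx S hS) f
    (hf.mono interior_subset) hpw
  obtain ⟨d, hd⟩ := hP.to_spl p hp
  refine ⟨d, c, ?_⟩
  have h1 : Set.EqOn f (spl p hp d c) (interior (tri p)) := by
    intro z hz
    rw [hform z hz, hd z]
    rfl
  refine h1.of_subset_closure hf.continuousOn (spl_contDiff p hp d c).continuous.continuousOn
    interior_subset ?_
  rw [(tri_convex p).closure_interior_eq_closure_of_nonempty_interior hne]
  exact subset_closure

lemma IsPolyDeg.sum {κ : Type*} (S : Finset κ) (g : κ → V2 → ℝ) (h : ∀ i ∈ S, IsPolyDeg 3 (g i)) :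
    IsPolyDeg 3 fun z => ∑ i ∈ S, g i z := by
  choose! q hq1 hq2 using h
  refine ⟨∑ i ∈ S, q i, MvPolynomial.totalDegree_finsetSum_le hq1, fun z => ?_⟩
  rw [map_sum]
  exact Finset.sum_congr rfl fun i hi => hq2 i hi z

lemma IsPolyDeg.add {g h : V2 → ℝ} (hg : IsPolyDeg 3 g) (hh : IsPolyDeg 3 h) :
    IsPolyDeg 3 fun z => g z + h z := by
  obtain ⟨q, hq1, hq2⟩ := hg
  obtain ⟨q', hq1', hq2'⟩ := hh
  exact ⟨q + q', (MvPolynomial.totalDegree_add _ _).trans (max_le hq1 hq1'), fun z => by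
    simp only [map_add, hq2, hq2']⟩

lemma isPolyDeg_cube (l : V2 →ᵃ[ℝ] ℝ) (c : ℝ) : IsPolyDeg 3 fun z => c * l z ^ 3 := by
  let q : MvPolynomial (Fin 2) ℝ := MvPolynomial.C (l.linear (EuclideanSpace.single 0 1)) *
    MvPolynomial.X 0 + MvPolynomial.C (l.linear (EuclideanSpace.single 1 1)) *
    MvPolynomial.X 1 + MvPolynomial.C (l 0)
  have hq : q.totalDegree ≤ 1 := by
    refine (MvPolynomial.totalDegree_add _ _).trans (max_le ((MvPolynomial.totalDegree_add _ _).trans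
      (max_le ?_ ?_)) ?_)
    · exact (MvPolynomial.totalDegree_mul _ _).trans (by simp)
    · exact (MvPolynomial.totalDegree_mul _ _).trans (by simp)
    · simp
  refine ⟨MvPolynomial.C c * q ^ 3, (MvPolynomial.totalDegree_mul _ _).trans ?_, fun z => ?_⟩
  · have := MvPolynomial.totalDegree_pow q 3
    rw [MvPolynomial.totalDegree_C]
    omega
  · have hz : z = z 0 • EuclideanSpace.single 0 (1 : ℝ) + z 1 • EuclideanSpace.single 1 (1 : ℝ) := by
      ext i
      fin_cases i <;> simp
    have hl : l z = l.linear (EuclideanSpace.single 0 1) * z 0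
        + l.linear (EuclideanSpace.single 1 1) * z 1 + l 0 := by
      rw [aff_eq]
      conv_lhs => rw [hz]
      simp only [LinearMap.coe_toContinuousLinearMap', map_add, map_smul, smul_eq_mul]
      ring
    simp only [hl]
    simp [q]

theorem spl_mem (p : Fin 3 → V2) (hp : AffineIndependent ℝ p) (d : Fin 10 → ℝ)
    (c : Fin 18 → ℝ) : (tri p).indicator (spl p hp d c) ∈ splineSpace p := by
  refine ⟨?_, ?_, ?_⟩
  · exact (spl_contDiff p hp d c).contDiffOn.congr fun z hz => Set.indicator_of_mem hz _
  · intro x hx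
    have hnz : ∀ z ∈ interior (tri p) \ cutLines p, ∀ m, lam p hp (lineTab m) z ≠ 0 :=
      fun z hz m hm => hz.2 (cut_sup p hp z m hm)
    refine ⟨fun z => ∑ i, d i * lam p hp (formTab i) z ^ 3
      + ∑ m, (c m * if 0 < lam p hp (lineTab m) x then 1 else 0) * lam p hp (lineTab m) z ^ 3,
      ?_, ?_⟩
    · exact (IsPolyDeg.sum _ _ fun i _ => isPolyDeg_cube _ _).add
        (IsPolyDeg.sum _ _ fun i _ => isPolyDeg_cube _ _)
    · intro z hz
      have hsub := connectedComponentIn_subset (interior (tri p) \ cutLines p) x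
      have hzt : z ∈ tri p := interior_subset (hsub hz).1
      rw [Set.indicator_of_mem hzt]
      unfold spl
      simp only
      congr 1
      refine Finset.sum_congr rfl fun m _ => ?_
      rw [mul_assoc]
      congr 1
      have hpre : IsPreconnected (connectedComponentIn (interior (tri p) \ cutLines p) x) :=
        isPreconnected_connectedComponentIn
      have hxm := mem_connectedComponentIn hx
      have hcon := (aff_cont (lam p hp (lineTab m))).continuousOn
        (s := connectedComponentIn (interior (tri p) \ cutLines p) x)
      rcases lt_or_gt_of_ne (hnz x hx m) with h | h
      · rw [if_neg h.not_gt, zero_mul, tp_of_nonpos]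
        by_contra h'
        push Not at h'
        obtain ⟨w, hw, hw0⟩ := hpre.intermediate_value hxm hz hcon ⟨h.le, h'.le⟩
        exact hnz w (hsub hw) m hw0
      · rw [if_pos h, one_mul, tp_of_nonneg]
        by_contra h'
        push Not at h'
        obtain ⟨w, hw, hw0⟩ := hpre.intermediate_value hz hxm hcon ⟨h'.le, h.le⟩
        exact hnz w (hsub hw) m hw0
  · intro x hx
    exact Set.indicator_of_notMem hx _

/-! ### Derivatives of the splines -/

/-- Index type of the 28 generating functions. -/
abbrev JJ := Fin 10 ⊕ Fin 18

/-- All 28 linear forms. -/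
def tab : JJ → Fin 3 → ℤ
  | Sum.inl i => formTab i
  | Sum.inr m => lineTab m

/-- Truncation (for the truncated cubes only). -/
noncomputable def trR : JJ → ℝ → ℝ
  | Sum.inl _ => fun t => t
  | Sum.inr _ => fun t => max t 0

/-- Integer version of the truncation. -/
def trZ : JJ → ℤ → ℤ
  | Sum.inl _ => fun t => t
  | Sum.inr _ => fun t => max t 0

/-- The linear functional with given coefficients. -/
noncomputable def ev (a : JJ → ℝ) : (JJ → ℝ) →ₗ[ℝ] ℝ := ∑ j, a j • LinearMap.proj j

lemma ev_apply (a θ : JJ → ℝ) : ev a θ = ∑ j, a j * θ j := by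
  simp [ev, LinearMap.sum_apply]

/-- Values of the generators. -/
noncomputable def co0 (p : Fin 3 → V2) (hp : AffineIndependent ℝ p) (z : V2) (j : JJ) : ℝ :=
  trR j (lam p hp (tab j) z) ^ 3

/-- First derivatives of the generators. -/
noncomputable def co1 (p : Fin 3 → V2) (hp : AffineIndependent ℝ p) (z v : V2) (j : JJ) : ℝ :=
  3 * trR j (lam p hp (tab j) z) ^ 2 * (lam p hp (tab j)).linear v

/-- Second derivatives of the generators. -/
noncomputable def co2 (p : Fin 3 → V2) (hp : AffineIndependent ℝ p) (z v w : V2) (j : JJ) : ℝ :=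
  6 * trR j (lam p hp (tab j) z) * (lam p hp (tab j)).linear v * (lam p hp (tab j)).linear w

/-- The spline with coefficient vector `θ`. -/
noncomputable def spn (p : Fin 3 → V2) (hp : AffineIndependent ℝ p) (θ : JJ → ℝ) (z : V2) : ℝ :=
  spl p hp (fun i => θ (Sum.inl i)) (fun i => θ (Sum.inr i)) z

lemma spn_eq (p : Fin 3 → V2) (hp : AffineIndependent ℝ p) (θ : JJ → ℝ) (z : V2) :
    spn p hp θ z = ev (co0 p hp z) θ := by
  rw [ev_apply, Fintype.sum_sum_type]
  unfold spn spl co0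
  congr 1 <;> refine Finset.sum_congr rfl fun i _ => mul_comm _ _

lemma trR_deriv (j : JJ) (t : ℝ) : HasDerivAt (fun t => trR j t ^ 3) (3 * trR j t ^ 2) t := by
  cases j with
  | inl i => simpa [trR] using hasDerivAt_pow 3 t
  | inr m => exact hasDerivAt_tp t

lemma trR_deriv' (j : JJ) (t : ℝ) :
    HasDerivAt (fun t => 3 * trR j t ^ 2) (6 * trR j t) t := by
  cases j with
  | inl i =>
    have := (hasDerivAt_pow 2 t).const_mul 3
    refine this.congr_deriv ?_
    simp only [trR]
    norm_num
    ring
  | inr m => exact hasDerivAt_tp' t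

lemma aff_hasFDeriv (l : V2 →ᵃ[ℝ] ℝ) (z : V2) :
    HasFDerivAt (fun z => l z) (LinearMap.toContinuousLinearMap l.linear) z := by
  have : (fun z => l z) = fun z => LinearMap.toContinuousLinearMap l.linear z + l 0 :=
    funext fun z => aff_eq l z
  rw [this]
  exact (ContinuousLinearMap.hasFDerivAt _).add_const _

/-- The linear part as a continuous linear map. -/
noncomputable def lnl (p : Fin 3 → V2) (hp : AffineIndependent ℝ p) (j : JJ) : V2 →L[ℝ] ℝ :=
  LinearMap.toContinuousLinearMap (lam p hp (tab j)).linear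

lemma spn_fderiv (p : Fin 3 → V2) (hp : AffineIndependent ℝ p) (θ : JJ → ℝ) (z : V2) :
    HasFDerivAt (spn p hp θ)
      (∑ j, θ j • (3 * trR j (lam p hp (tab j) z) ^ 2) • lnl p hp j) z := by
  have e : spn p hp θ = fun z => ∑ j, θ j • trR j (lam p hp (tab j) z) ^ 3 := by
    funext z
    rw [spn_eq, ev_apply]
    exact Finset.sum_congr rfl fun j _ => mul_comm _ _
  rw [e]
  refine HasFDerivAt.fun_sum fun j _ => HasFDerivAt.fun_const_smul ?_ _
  exact (trR_deriv j _).comp_hasFDerivAt z (aff_hasFDeriv (lam p hp (tab j)) z)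

lemma spn_fderiv2 (p : Fin 3 → V2) (hp : AffineIndependent ℝ p) (θ : JJ → ℝ) (z : V2) :
    HasFDerivAt (fderiv ℝ (spn p hp θ))
      (∑ j, θ j • ((6 * trR j (lam p hp (tab j) z)) • lnl p hp j).smulRight (lnl p hp j)) z := by
  have e : fderiv ℝ (spn p hp θ)
      = fun z => ∑ j, θ j • (3 * trR j (lam p hp (tab j) z) ^ 2) • lnl p hp j :=
    funext fun z => (spn_fderiv p hp θ z).fderiv
  rw [e]
  refine HasFDerivAt.fun_sum fun j _ => ?_
  have h1 := (trR_deriv' j _).comp_hasFDerivAt z (aff_hasFDeriv (lam p hp (tab j)) z)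
  have h2 := h1.smul_const (lnl p hp j)
  exact h2.const_smul (θ j)

lemma spn_contDiff (p : Fin 3 → V2) (hp : AffineIndependent ℝ p) (θ : JJ → ℝ) :
    ContDiff ℝ 2 (spn p hp θ) := spl_contDiff p hp _ _

lemma tri_unique (p : Fin 3 → V2) (hp : AffineIndependent ℝ p) : UniqueDiffOn ℝ (tri p) :=
  uniqueDiffOn_convex (tri_convex p) ⟨_, bctr_mem p hp⟩

lemma it0 (p : Fin 3 → V2) (hp : AffineIndependent ℝ p) (θ : JJ → ℝ) (s : V2 → ℝ)
    (h : Set.EqOn s (spn p hp θ) (tri p)) (x : V2) (hx : x ∈ tri p) (m : Fin 0 → V2) :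
    iteratedFDerivWithin ℝ 0 s (tri p) x m = ev (co0 p hp x) θ := by
  rw [iteratedFDerivWithin_zero_apply, h hx, spn_eq]

lemma it1 (p : Fin 3 → V2) (hp : AffineIndependent ℝ p) (θ : JJ → ℝ) (s : V2 → ℝ)
    (h : Set.EqOn s (spn p hp θ) (tri p)) (x : V2) (hx : x ∈ tri p) (m : Fin 1 → V2) :
    iteratedFDerivWithin ℝ 1 s (tri p) x m = ev (co1 p hp x (m 0)) θ := by
  rw [iteratedFDerivWithin_congr h hx, iteratedFDerivWithin_eq_iteratedFDeriv (tri_unique p hp)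
    ((spn_contDiff p hp θ).contDiffAt.of_le (by norm_num)) hx, iteratedFDeriv_one_apply,
    (spn_fderiv p hp θ x).fderiv, ev_apply]
  simp only [ContinuousLinearMap.sum_apply, ContinuousLinearMap.smul_apply, smul_eq_mul]
  refine Finset.sum_congr rfl fun j _ => ?_
  unfold co1 lnl
  rw [LinearMap.coe_toContinuousLinearMap']
  ring

lemma it2 (p : Fin 3 → V2) (hp : AffineIndependent ℝ p) (θ : JJ → ℝ) (s : V2 → ℝ)
    (h : Set.EqOn s (spn p hp θ) (tri p)) (x : V2) (hx : x ∈ tri p) (m : Fin 2 → V2) :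
    iteratedFDerivWithin ℝ 2 s (tri p) x m = ev (co2 p hp x (m 0) (m 1)) θ := by
  rw [iteratedFDerivWithin_congr h hx, iteratedFDerivWithin_eq_iteratedFDeriv (tri_unique p hp)
    ((spn_contDiff p hp θ).contDiffAt) hx, iteratedFDeriv_two_apply,
    (spn_fderiv2 p hp θ x).fderiv, ev_apply]
  simp only [ContinuousLinearMap.sum_apply, ContinuousLinearMap.smul_apply, smul_eq_mul,
    ContinuousLinearMap.smulRight_apply]
  refine Finset.sum_congr rfl fun j _ => ?_
  unfold co2 lnl
  rw [LinearMap.coe_toContinuousLinearMap']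
  ring

lemma ev_co1_comb (p : Fin 3 → V2) (hp : AffineIndependent ℝ p) (θ : JJ → ℝ) (z v w : V2)
    (a b : ℝ) : ev (co1 p hp z (a • v + b • w)) θ
      = a * ev (co1 p hp z v) θ + b * ev (co1 p hp z w) θ := by
  simp only [ev_apply, Finset.mul_sum, ← Finset.sum_add_distrib]
  refine Finset.sum_congr rfl fun j _ => ?_
  simp only [co1, map_add, map_smul, smul_eq_mul]
  ring

lemma ev_co2_comb (p : Fin 3 → V2) (hp : AffineIndependent ℝ p) (θ : JJ → ℝ) (z v w v' w' : V2)
    (a b a' b' : ℝ) : ev (co2 p hp z (a • v + b • w) (a' • v' + b' • w')) θ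
      = a * a' * ev (co2 p hp z v v') θ + a * b' * ev (co2 p hp z v w') θ
        + b * a' * ev (co2 p hp z w v') θ + b * b' * ev (co2 p hp z w w') θ := by
  simp only [ev_apply, Finset.mul_sum, ← Finset.sum_add_distrib]
  refine Finset.sum_congr rfl fun j _ => ?_
  simp only [co2, map_add, map_smul, smul_eq_mul]
  ring

lemma co2_symm (p : Fin 3 → V2) (hp : AffineIndependent ℝ p) (z v w : V2) :
    co2 p hp z v w = co2 p hp z w v := by
  funext j
  unfold co2
  ring

/-! ### Integer certificates -/

/-- Index type of the 28 interpolation functionals. -/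
abbrev KK := (Fin 3 × Fin 6) ⊕ (Fin 3 ⊕ ((Fin 3 × Fin 2) ⊕ Unit))

/-- Value row at a point with six-fold barycentric coordinates `w`. -/
def rz0 (w : Fin 3 → ℤ) (j : JJ) : ℤ := trZ j (zdot (tab j) w) ^ 3

/-- First derivative row. -/
def rz1 (w v : Fin 3 → ℤ) (j : JJ) : ℤ := 3 * trZ j (zdot (tab j) w) ^ 2 * zdot (tab j) v

/-- Second derivative row. -/
def rz2 (w v u : Fin 3 → ℤ) (j : JJ) : ℤ :=
  6 * trZ j (zdot (tab j) w) * zdot (tab j) v * zdot (tab j) u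

/-- Barycentric direction `p i - p j`. -/
def dz (i j : Fin 3) (t : Fin 3) : ℤ := (if t = i then 1 else 0) - (if t = j then 1 else 0)

/-- Vertices. -/
def wv (k t : Fin 3) : ℤ := if t = k then 6 else 0

/-- Midpoints. -/
def wm (k t : Fin 3) : ℤ := if t = k then 0 else 3

/-- Trisection points. -/
def wt (k l t : Fin 3) : ℤ := if t = k then 0 else if t = l then 4 else 2

/-- Barycenter. -/
def wb (_ : Fin 3) : ℤ := 2

/-- Second index of a trisection point. -/
def li (k : Fin 3) : Fin 2 → Fin 3 := ![k + 1, k + 2]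

/-- Vertex rows. -/
def vrow (w : Fin 3 → ℤ) : Fin 6 → JJ → ℤ :=
  ![rz0 w, rz1 w (dz 1 0), rz1 w (dz 2 0), rz2 w (dz 1 0) (dz 1 0), rz2 w (dz 1 0) (dz 2 0),
    rz2 w (dz 2 0) (dz 2 0)]

/-- All rows. -/
def rowM : KK → JJ → ℤ
  | Sum.inl (k, a) => vrow (wv k) a
  | Sum.inr (Sum.inl k) => rz1 (wm k) (dz k (k + 1))
  | Sum.inr (Sum.inr (Sum.inl (k, b))) => rz2 (wt k (li k b)) (dz k (k + 1)) (dz k (k + 1))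
  | Sum.inr (Sum.inr (Sum.inr _)) => rz0 wb

/-- Position of a functional in the inverse matrix. -/
def idx : KK → Fin 28
  | Sum.inl (k, a) => ⟨6 * k + a, by omega⟩
  | Sum.inr (Sum.inl k) => ⟨18 + k, by omega⟩
  | Sum.inr (Sum.inr (Sum.inl (k, b))) => ⟨21 + (2 * k + b), by omega⟩
  | Sum.inr (Sum.inr (Sum.inr _)) => 27

/-- Inverse matrix (times `DD`), rows of the pure cubes. -/
def invA : Fin 10 → Fin 28 → ℤ :=
  ![![-1215, -1071, -1692, -216, -1566, -171, -3888, 7668, -5733, -4644, 7137, -3564, -1701, -2637, 3231, -1836, 2097, -1665, -7344, -1800, -1224, -2052, -2052, -540, -972, -972, -540, 6804],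
    ![-1215, 918, -2421, 216, 2223, -3132, -1701, 4167, -1287, -3249, 2646, -864, -3888, -1935, 7668, -1071, 2151, -4644, -1224, -7344, -1800, -972, -540, -2052, -2052, 1404, -972, 6804],
    ![-1701, -414, -990, -972, 4446, -3744, -1701, 3231, -918, -1665, 1557, -1404, -3402, -1179, 6840, -819, 1827, -4788, -1800, -7056, -4752, -540, -972, -972, -2484, 2808, -2052, 6804],
    ![486, 126, 900, 0, 288, 414, 972, -1818, 1350, 954, -1548, 864, 486, 144, -342, 126, 1152, -846, 1872, 1584, 432, 432, 648, 648, 432, 216, 216, -1944],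
    ![0, -150, 54, -144, -102, 150, 0, 330, -24, -546, 390, 72, 0, -72, 114, 42, 144, -114, 336, 336, 192, -360, 144, -144, 360, -144, 144, 0],
    ![972, 1566, 360, 864, 468, -54, 486, -342, 198, -846, 540, 432, 486, 684, -918, 414, -468, 378, 1584, 432, 1872, 648, 432, 216, 216, 432, 648, -1944],
    ![0, 24, 198, -72, 534, -240, 0, -114, 42, 114, -84, -72, 0, -54, 12, -150, 198, -228, -336, -192, -336, 144, -360, 144, -144, 360, -144, 0],
    ![486, 90, 603, 108, -513, 774, 486, -918, 315, 378, -369, 324, 972, 468, -1818, 270, -360, 954, 432, 1872, 936, 216, 216, 432, 648, -324, 432, -1944],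
    ![0, 66, -747, 396, -1767, 690, 0, -12, -123, 228, -177, 180, 0, -306, 330, -84, 702, -546, 192, 336, 984, -144, 144, -360, 144, -1116, 360, 0],
    ![-324, -348, -336, -144, -264, -60, -216, 252, -132, 180, -96, -144, -216, -120, 252, -60, -264, 180, -480, -480, -480, -192, -192, -192, -192, -192, -192, 864]]

/-- Inverse matrix (times `DD`), rows of the truncated cubes. -/
def invB : Fin 18 → Fin 28 → ℤ :=
  ![![0, 54, -54, 0, 54, -54, 243, -351, 486, 189, -513, 324, -243, 351, 594, 459, -675, -432, 1080, -432, 0, 0, 648, -324, 0, 0, 0, 0],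
    ![0, -27, 27, 0, -27, 27, -243, 378, -486, -216, 540, -324, 243, 27, -783, -594, 297, 621, -864, 216, 0, 0, -324, 648, 0, 0, 0, 0],
    ![-108, -147, -69, -108, -3, -33, -135, 213, -198, -123, 195, -144, -81, -96, 129, -57, -12, -3, -312, -120, -144, 36, -108, -108, 36, -36, -36, 324],
    ![27, 14, 36, 12, -8, 28, 27, -77, 20, 59, -49, 12, 54, -3, -116, -23, 27, 80, -40, 80, 32, 36, -60, 36, 12, 0, 12, -108],
    ![54, 119, -3, 84, 19, -23, 27, -50, 14, 32, -16, 12, 27, 57, -77, 22, -69, 59, 32, -40, 80, 0, 12, 36, -60, 36, 12, -108],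
    ![-108, 126, -294, 72, 102, -270, -162, 408, -132, -300, 252, -72, -378, -42, 774, 120, -30, -522, 96, -720, -96, -72, 72, -216, -216, 72, -72, 648],
    ![-243, -945, 351, -648, -243, 459, 0, 0, 54, 0, -54, 0, 243, -135, -351, 0, 135, 189, 0, 1080, -432, 0, 0, 0, 648, -324, 0, 0],
    ![54, 94, 6, 60, 2, 2, 27, -13, 10, -5, 49, 24, 27, 45, -58, 29, -45, 40, 88, 16, 112, -60, 36, 12, 0, 12, 36, -108],
    ![-135, -198, -15, -144, 93, -72, -81, 129, -33, -3, 18, -72, -108, -69, 216, -33, 69, -144, -120, -144, -312, -108, 36, -36, -36, 36, -108, 324],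
    ![-378, -732, -42, -432, -210, 120, -108, 168, 126, -96, -246, 72, -162, -276, 408, -120, 348, -300, -96, 96, -720, 72, -72, -72, 72, -216, -216, 648],
    ![27, 10, 3, 24, -97, 68, 27, -58, 13, 40, -35, 24, 54, 6, -100, 2, -6, 64, 16, 112, 88, 12, 0, 12, 36, -60, 36, -108],
    ![243, 756, 27, 324, 891, -594, 0, 0, -27, 0, 27, 0, -243, 108, 378, 0, -108, -216, 0, -864, 216, 0, 0, 0, -324, 648, 0, 0],
    ![-243, -486, 108, -324, 108, 0, 243, -783, 756, 621, -1539, 324, 0, 27, 0, 27, -27, 0, 216, 0, -864, 648, 0, 0, 0, 0, -324, 0],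
    ![243, 486, -135, 324, -135, 0, -243, 594, -945, -432, 1539, -648, 0, -54, 0, -54, 54, 0, -432, 0, 1080, -324, 0, 0, 0, 0, 648, 0],
    ![-162, -132, -276, -72, -108, -120, -378, 774, -732, -522, 1074, -432, -108, -294, 168, -270, 438, -96, -720, -96, 96, -216, -216, 72, -72, -72, 72, 648],
    ![27, 13, 45, 24, -13, 29, 54, -100, 94, 64, -122, 60, 27, 3, -13, 68, -39, -5, 112, 88, 16, 12, 36, -60, 36, 12, 0, -108],
    ![27, 20, 57, 12, 25, 22, 54, -116, 119, 80, -187, 84, 27, 36, -50, 28, -48, 32, 80, 32, -40, 36, 12, 0, 12, 36, -60, -108],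
    ![-81, -33, -96, -72, 126, -57, -108, 216, -147, -144, 219, -108, -135, -15, 213, -72, 51, -123, -144, -312, -120, -36, -36, 36, -108, -108, 36, 324]]

/-- Common denominator. -/
def DD : ℤ := 23328

/-- The inverse matrix (times `DD`). -/
def matN : JJ → KK → ℤ
  | Sum.inl i, κ => invA i (idx κ)
  | Sum.inr m, κ => invB m (idx κ)

/-- Expansion of a row in terms of the interpolation functionals. -/
def expd (r : JJ → ℤ) (κ : KK) : ℤ :=
  ∑ i, r (Sum.inl i) * invA i (idx κ) + ∑ m, r (Sum.inr m) * invB m (idx κ)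

lemma inv_cert : ∀ j j' : JJ, ∑ κ, matN j κ * rowM κ j' = if j = j' then DD else 0 := by
  decide +kernel

lemma sup_mid : ∀ k κ, expd (rz1 (wm k) (dz (k + 2) (k + 1))) (Sum.inr κ) = 0 := by
  decide +kernel

lemma sup_ee : ∀ k b κ,
    expd (rz2 (wt k (li k b)) (dz (k + 2) (k + 1)) (dz (k + 2) (k + 1))) (Sum.inr κ) = 0 := by
  decide +kernel

lemma sup_ew : ∀ k b κ,
    expd (rz2 (wt k (li k b)) (dz (k + 2) (k + 1)) (dz k (k + 1))) (Sum.inr (Sum.inr κ)) = 0 := by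
  decide +kernel

/-- Integer rows as functionals. -/
noncomputable def evZ (r : JJ → ℤ) : (JJ → ℝ) →ₗ[ℝ] ℝ := ev fun j => (r j : ℝ)

lemma expd_eq (r : JJ → ℤ) (κ : KK) : expd r κ = ∑ j, r j * matN j κ := by
  rw [Fintype.sum_sum_type]
  rfl

lemma evZ_expand (r : JJ → ℤ) (θ : JJ → ℝ) :
    (DD : ℝ) * evZ r θ = ∑ κ, (expd r κ : ℝ) * evZ (rowM κ) θ := by
  have h : ∀ j' : JJ, ∑ κ, expd r κ * rowM κ j' = DD * r j' := by
    intro j'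
    simp only [expd_eq, Finset.sum_mul, mul_assoc]
    rw [Finset.sum_comm]
    simp only [← Finset.mul_sum, inv_cert]
    simp [mul_comm]
  have h' : ∀ j' : JJ, ∑ κ, (expd r κ : ℝ) * (rowM κ j' : ℝ) = (DD : ℝ) * r j' := by
    intro j'
    exact_mod_cast h j'
  simp only [evZ, ev_apply, Finset.mul_sum, ← mul_assoc]
  rw [Finset.sum_comm]
  simp only [← Finset.sum_mul, h']

lemma evZ_zero (r : JJ → ℤ) (θ : JJ → ℝ)
    (h : ∀ κ, expd r κ = 0 ∨ evZ (rowM κ) θ = 0) : evZ r θ = 0 := by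
  have hD : (DD : ℝ) ≠ 0 := by norm_num [DD]
  have := evZ_expand r θ
  rw [Finset.sum_eq_zero fun κ _ => by rcases h κ with h | h <;> simp [h]] at this
  exact (mul_eq_zero.1 this).resolve_left hD

lemma theta_zero (θ : JJ → ℝ) (h : ∀ κ, evZ (rowM κ) θ = 0) : θ = 0 := by
  funext j
  have := evZ_zero (fun j' => if j' = j then 1 else 0) θ fun κ => Or.inr (h κ)
  simpa [evZ, ev_apply] using this


/-! ### Interpolation functionals -/

/-- `x` has six-fold barycentric coordinates `w`. -/
def IsPt (p : Fin 3 → V2) (hp : AffineIndependent ℝ p) (x : V2) (w : Fin 3 → ℤ) : Prop :=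
  ∀ t, (tb p hp).coord t x = (w t : ℝ) / 6

/-- `v` has barycentric direction `d`. -/
def IsDir (p : Fin 3 → V2) (hp : AffineIndependent ℝ p) (v : V2) (d : Fin 3 → ℤ) : Prop :=
  ∀ a, (lam p hp a).linear v = (zdot a d : ℝ)

lemma isDir_sub (p : Fin 3 → V2) (hp : AffineIndependent ℝ p) (i j : Fin 3) :
    IsDir p hp (p i - p j) (dz i j) := by
  intro a
  have hc : ∀ k, lam p hp a (p k) = a k := by
    intro k
    rw [lam_apply]
    have e : ∀ j, (tb p hp).coord j (p k) = if j = k then 1 else 0 := fun j =>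
      (tb p hp).coord_apply j k
    simp only [e]
    fin_cases k <;> simp
  have := aff_add (lam p hp a) (p j) (p i - p j)
  rw [add_sub_cancel, hc, hc] at this
  have e : (zdot a (dz i j) : ℝ) = a i - a j := by
    unfold zdot dz
    fin_cases i <;> fin_cases j <;> simp <;> ring
  rw [e]
  linarith

lemma isPt_of (p : Fin 3 → V2) (hp : AffineIndependent ℝ p) (x : V2) (w : Fin 3 → ℤ)
    (hw : w 0 + w 1 + w 2 = 6)
    (hx : x = ((w 0 : ℝ) / 6) • p 0 + ((w 1 : ℝ) / 6) • p 1 + ((w 2 : ℝ) / 6) • p 2) :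
    IsPt p hp x w := by
  intro t
  rw [hx]
  refine tb_coord p hp (fun t => (w t : ℝ) / 6) ?_ t
  have : (w 0 : ℝ) + w 1 + w 2 = 6 := by exact_mod_cast hw
  linarith

lemma isPt_vertex (p : Fin 3 → V2) (hp : AffineIndependent ℝ p) (k : Fin 3) :
    IsPt p hp (p k) (wv k) := by
  refine isPt_of p hp _ _ ?_ ?_ <;> fin_cases k <;> simp [wv]

lemma isPt_mid (p : Fin 3 → V2) (hp : AffineIndependent ℝ p) (k : Fin 3) :
    IsPt p hp (qmid p k) (wm k) := by
  refine isPt_of p hp _ _ ?_ ?_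
  · fin_cases k <;> simp [wm]
  · fin_cases k
    · have e1 : (0 : Fin 3) + 1 = 1 := rfl
      have e2 : (0 : Fin 3) + 2 = 2 := rfl
      simp [qmid, wm]
      norm_num
    · have e1 : (1 : Fin 3) + 1 = 2 := rfl
      have e2 : (1 : Fin 3) + 2 = 0 := rfl
      simp [qmid, wm, e1, e2]
      norm_num
      rw [add_comm]
    · have e1 : (2 : Fin 3) + 1 = 0 := rfl
      have e2 : (2 : Fin 3) + 2 = 1 := rfl
      simp [qmid, wm, e1, e2]
      norm_num

lemma isPt_tris (p : Fin 3 → V2) (hp : AffineIndependent ℝ p) (k l : Fin 3) (h : k ≠ l) :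
    IsPt p hp (ptrisect p k l) (wt k l) := by
  have e1 : thirdIdx 0 1 = 2 := rfl
  have e2 : thirdIdx 0 2 = 1 := rfl
  have e3 : thirdIdx 1 0 = 2 := rfl
  have e4 : thirdIdx 1 2 = 0 := rfl
  have e5 : thirdIdx 2 0 = 1 := rfl
  have e6 : thirdIdx 2 1 = 0 := rfl
  refine isPt_of p hp _ _ ?_ ?_
  · fin_cases k <;> fin_cases l <;> simp [wt] at h ⊢
  · fin_cases k <;> fin_cases l <;> simp [wt, ptrisect, e1, e2, e3, e4, e5, e6] at h ⊢ <;>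
      norm_num <;> first | done | exact add_comm _ _

lemma isPt_bctr (p : Fin 3 → V2) (hp : AffineIndependent ℝ p) :
    IsPt p hp (bctr p) wb := by
  refine isPt_of p hp _ _ (by simp [wb]) ?_
  simp only [bctr, wb]
  norm_num

lemma isPt_mem (p : Fin 3 → V2) (hp : AffineIndependent ℝ p) (x : V2) (w : Fin 3 → ℤ)
    (h : IsPt p hp x w) (hw : ∀ t, 0 ≤ w t) : x ∈ tri p := by
  rw [tri_eq p hp]
  intro k
  rw [h k]
  have : (0 : ℝ) ≤ w k := by exact_mod_cast hw k
  positivity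

lemma mem_vertex (p : Fin 3 → V2) (hp : AffineIndependent ℝ p) (k : Fin 3) : p k ∈ tri p :=
  isPt_mem p hp _ _ (isPt_vertex p hp k) fun t => by unfold wv; split_ifs <;> norm_num

lemma mem_mid (p : Fin 3 → V2) (hp : AffineIndependent ℝ p) (k : Fin 3) : qmid p k ∈ tri p :=
  isPt_mem p hp _ _ (isPt_mid p hp k) fun t => by unfold wm; split_ifs <;> norm_num

lemma mem_tris (p : Fin 3 → V2) (hp : AffineIndependent ℝ p) (k l : Fin 3) (h : k ≠ l) :
    ptrisect p k l ∈ tri p :=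
  isPt_mem p hp _ _ (isPt_tris p hp k l h) fun t => by unfold wt; split_ifs <;> norm_num

lemma lam_pt (p : Fin 3 → V2) (hp : AffineIndependent ℝ p) (x : V2) (w : Fin 3 → ℤ)
    (h : IsPt p hp x w) (a : Fin 3 → ℤ) : lam p hp a x = (zdot a w : ℝ) / 6 := by
  rw [lam_apply, h 0, h 1, h 2]
  unfold zdot
  push_cast
  ring

lemma trR_div (j : JJ) (n : ℤ) : trR j ((n : ℝ) / 6) = (trZ j n : ℝ) / 6 := by
  cases j with
  | inl i => rfl
  | inr m =>
    simp only [trR, trZ]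
    push_cast
    rcases le_total (n : ℝ) 0 with h | h
    · rw [max_eq_right h, max_eq_right (by linarith)]
      simp
    · rw [max_eq_left h, max_eq_left (by linarith)]

lemma ev_co0 (p : Fin 3 → V2) (hp : AffineIndependent ℝ p) (x : V2) (w : Fin 3 → ℤ)
    (h : IsPt p hp x w) (θ : JJ → ℝ) : 216 * ev (co0 p hp x) θ = evZ (rz0 w) θ := by
  simp only [evZ, ev_apply, Finset.mul_sum]
  refine Finset.sum_congr rfl fun j _ => ?_
  simp only [co0, rz0, lam_pt p hp x w h, trR_div]
  push_cast
  ring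

lemma ev_co1 (p : Fin 3 → V2) (hp : AffineIndependent ℝ p) (x : V2) (w : Fin 3 → ℤ)
    (h : IsPt p hp x w) (v : V2) (d : Fin 3 → ℤ) (hv : IsDir p hp v d) (θ : JJ → ℝ) :
    36 * ev (co1 p hp x v) θ = evZ (rz1 w d) θ := by
  simp only [evZ, ev_apply, Finset.mul_sum]
  refine Finset.sum_congr rfl fun j _ => ?_
  simp only [co1, rz1, lam_pt p hp x w h, trR_div, hv (tab j)]
  push_cast
  ring

lemma ev_co2 (p : Fin 3 → V2) (hp : AffineIndependent ℝ p) (x : V2) (w : Fin 3 → ℤ)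
    (h : IsPt p hp x w) (v v' : V2) (d d' : Fin 3 → ℤ) (hv : IsDir p hp v d)
    (hv' : IsDir p hp v' d') (θ : JJ → ℝ) :
    6 * ev (co2 p hp x v v') θ = evZ (rz2 w d d') θ := by
  simp only [evZ, ev_apply, Finset.mul_sum]
  refine Finset.sum_congr rfl fun j _ => ?_
  simp only [co2, rz2, lam_pt p hp x w h, trR_div, hv (tab j), hv' (tab j)]
  push_cast
  ring

lemma dir_decomp (p : Fin 3 → V2) (hp : AffineIndependent ℝ p) (k : Fin 3) (v : V2) :
    ∃ a b : ℝ, v = a • (p (k + 2) - p (k + 1)) + b • (p k - p (k + 1)) := by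
  have hs := tb_self p hp (p (k + 1) + v)
  have h1 := tb_sum p hp (p (k + 1) + v)
  refine ⟨(tb p hp).coord (k + 2) (p (k + 1) + v), (tb p hp).coord k (p (k + 1) + v), ?_⟩
  have hv : v = (p (k + 1) + v) - p (k + 1) := by abel
  generalize p (k + 1) + v = z at *
  rw [hv]
  nth_rewrite 1 [hs]
  have e : p (k + 1) = ((tb p hp).coord 0 z + (tb p hp).coord 1 z + (tb p hp).coord 2 z) •
      p (k + 1) := by rw [h1, one_smul]
  nth_rewrite 1 [e]
  have e1 : (1 : Fin 3) + 1 = 2 := rfl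
  have e2 : (1 : Fin 3) + 2 = 0 := rfl
  have e3 : (2 : Fin 3) + 1 = 0 := rfl
  have e4 : (2 : Fin 3) + 2 = 1 := rfl
  fin_cases k
  · simp only [Fin.zero_eta, zero_add]
    module
  · simp only [Fin.mk_one, e1, e2]
    module
  · simp only [Fin.reduceFinMk, e3, e4]
    module

lemma normal_decomp (p : Fin 3 → V2) (hp : AffineIndependent ℝ p) (k : Fin 3) (n : V2)
    (hn : n ≠ 0 ∧ ⟪n, p (k + 2) - p (k + 1)⟫ = 0) :
    ∃ a b : ℝ, b ≠ 0 ∧ n = a • (p (k + 2) - p (k + 1)) + b • (p k - p (k + 1)) := by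
  obtain ⟨a, b, h⟩ := dir_decomp p hp k n
  refine ⟨a, b, ?_, h⟩
  rintro rfl
  rw [zero_smul, add_zero] at h
  apply hn.1
  rw [← inner_self_eq_zero (𝕜 := ℝ)]
  nth_rewrite 2 [h]
  rw [inner_smul_right, hn.2, mul_zero]

lemma ee_decomp (v : V2) : v = v 0 • ee 0 + v 1 • ee 1 := by
  ext i
  fin_cases i <;> simp [ee]


/-- The vertex functionals. -/
noncomputable def vR (p : Fin 3 → V2) (hp : AffineIndependent ℝ p) (x : V2) :
    Fin 6 → JJ → ℝ :=
  ![co0 p hp x, co1 p hp x (ee 0), co1 p hp x (ee 1), co2 p hp x (ee 0) (ee 0),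
    co2 p hp x (ee 0) (ee 1), co2 p hp x (ee 1) (ee 1)]

lemma vR0 (p : Fin 3 → V2) (hp : AffineIndependent ℝ p) (x : V2) :
    vR p hp x 0 = co0 p hp x := rfl

lemma vR1 (p : Fin 3 → V2) (hp : AffineIndependent ℝ p) (x : V2) :
    vR p hp x 1 = co1 p hp x (ee 0) := rfl

lemma vR2 (p : Fin 3 → V2) (hp : AffineIndependent ℝ p) (x : V2) :
    vR p hp x 2 = co1 p hp x (ee 1) := rfl

lemma vR3 (p : Fin 3 → V2) (hp : AffineIndependent ℝ p) (x : V2) :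
    vR p hp x 3 = co2 p hp x (ee 0) (ee 0) := rfl

lemma vR4 (p : Fin 3 → V2) (hp : AffineIndependent ℝ p) (x : V2) :
    vR p hp x 4 = co2 p hp x (ee 0) (ee 1) := rfl

lemma vR5 (p : Fin 3 → V2) (hp : AffineIndependent ℝ p) (x : V2) :
    vR p hp x 5 = co2 p hp x (ee 1) (ee 1) := rfl

/-- All interpolation functionals. -/
noncomputable def rowR (p : Fin 3 → V2) (hp : AffineIndependent ℝ p) (nk : Fin 3 → V2) :
    KK → JJ → ℝ
  | Sum.inl (k, a) => vR p hp (p k) a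
  | Sum.inr (Sum.inl k) => co1 p hp (qmid p k) (nk k)
  | Sum.inr (Sum.inr (Sum.inl (k, b))) => co2 p hp (ptrisect p k (li k b)) (nk k) (nk k)
  | Sum.inr (Sum.inr (Sum.inr _)) => co0 p hp (bctr p)

lemma li_ne : ∀ k b, k ≠ li k b := by decide

lemma vertex_zero (p : Fin 3 → V2) (hp : AffineIndependent ℝ p) (k : Fin 3) (θ : JJ → ℝ)
    (h : ∀ a, ev (vR p hp (p k) a) θ = 0) (a : Fin 6) : evZ (rowM (Sum.inl (k, a))) θ = 0 := by
  have h1 : ∀ v, ev (co1 p hp (p k) v) θ = 0 := by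
    intro v
    rw [ee_decomp v, ev_co1_comb, ← vR1, h 1,
      ← vR2, h 2]
    simp
  have h2 : ∀ v w, ev (co2 p hp (p k) v w) θ = 0 := by
    intro v w
    rw [ee_decomp v, ee_decomp w, ev_co2_comb, co2_symm p hp (p k) (ee 1) (ee 0),
      ← vR3, h 3,
      ← vR4, h 4,
      ← vR5, h 5]
    simp
  have hx := isPt_vertex p hp k
  have d1 := isDir_sub p hp 1 0
  have d2 := isDir_sub p hp 2 0
  fin_cases a
  · exact (ev_co0 p hp _ _ hx θ).symm.trans
      (by rw [← vR0, h 0, mul_zero])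
  · exact (ev_co1 p hp _ _ hx _ _ d1 θ).symm.trans (by rw [h1, mul_zero])
  · exact (ev_co1 p hp _ _ hx _ _ d2 θ).symm.trans (by rw [h1, mul_zero])
  · exact (ev_co2 p hp _ _ hx _ _ _ _ d1 d1 θ).symm.trans (by rw [h2, mul_zero])
  · exact (ev_co2 p hp _ _ hx _ _ _ _ d1 d2 θ).symm.trans (by rw [h2, mul_zero])
  · exact (ev_co2 p hp _ _ hx _ _ _ _ d2 d2 θ).symm.trans (by rw [h2, mul_zero])

lemma ker_zero (p : Fin 3 → V2) (hp : AffineIndependent ℝ p)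
    (nk : Fin 3 → V2) (hnk : ∀ k, nk k ≠ 0 ∧ ⟪nk k, p (k + 2) - p (k + 1)⟫ = 0)
    (θ : JJ → ℝ) (h : ∀ κ, ev (rowR p hp nk κ) θ = 0) : θ = 0 := by
  have hv : ∀ q, evZ (rowM (Sum.inl q)) θ = 0 := fun q =>
    vertex_zero p hp q.1 θ (fun a => h (Sum.inl (q.1, a))) q.2
  have hm : ∀ k, evZ (rowM (Sum.inr (Sum.inl k))) θ = 0 := by
    intro k
    obtain ⟨a, b, hb, e⟩ := normal_decomp p hp k (nk k) (hnk k)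
    have h1 : ev (co1 p hp (qmid p k) (nk k)) θ = 0 := h (Sum.inr (Sum.inl k))
    rw [e, ev_co1_comb] at h1
    have h2 : evZ (rz1 (wm k) (dz (k + 2) (k + 1))) θ = 0 := by
      refine evZ_zero _ θ fun κ => ?_
      rcases κ with q | κ
      · exact Or.inr (hv q)
      · exact Or.inl (sup_mid k κ)
    have h3 := ev_co1 p hp _ _ (isPt_mid p hp k) _ _ (isDir_sub p hp (k + 2) (k + 1)) θ
    have h4 := ev_co1 p hp _ _ (isPt_mid p hp k) _ _ (isDir_sub p hp k (k + 1)) θ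
    have h5 : ev (co1 p hp (qmid p k) (p (k + 2) - p (k + 1))) θ = 0 := by linarith
    rw [h5, mul_zero, zero_add] at h1
    rw [(mul_eq_zero.1 h1).resolve_left hb, mul_zero] at h4
    exact h4.symm
  have ht : ∀ k b, evZ (rowM (Sum.inr (Sum.inr (Sum.inl (k, b))))) θ = 0 := by
    intro k b
    obtain ⟨α, β, hβ, e⟩ := normal_decomp p hp k (nk k) (hnk k)
    have h1 : ev (co2 p hp (ptrisect p k (li k b)) (nk k) (nk k)) θ = 0 :=
      h (Sum.inr (Sum.inr (Sum.inl (k, b))))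
    rw [e, ev_co2_comb, co2_symm p hp _ (p k - p (k + 1)) (p (k + 2) - p (k + 1))] at h1
    have hx := isPt_tris p hp k (li k b) (li_ne k b)
    have de := isDir_sub p hp (k + 2) (k + 1)
    have dw := isDir_sub p hp k (k + 1)
    have hee : evZ (rz2 (wt k (li k b)) (dz (k + 2) (k + 1)) (dz (k + 2) (k + 1))) θ = 0 := by
      refine evZ_zero _ θ fun κ => ?_
      rcases κ with q | κ
      · exact Or.inr (hv q)
      · exact Or.inl (sup_ee k b κ)
    have hew : evZ (rz2 (wt k (li k b)) (dz (k + 2) (k + 1)) (dz k (k + 1))) θ = 0 := by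
      refine evZ_zero _ θ fun κ => ?_
      rcases κ with q | k' | κ
      · exact Or.inr (hv q)
      · exact Or.inr (hm k')
      · exact Or.inl (sup_ew k b κ)
    have h3 := ev_co2 p hp _ _ hx _ _ _ _ de de θ
    have h4 := ev_co2 p hp _ _ hx _ _ _ _ de dw θ
    have h5 := ev_co2 p hp _ _ hx _ _ _ _ dw dw θ
    rw [hee] at h3
    rw [hew] at h4
    rw [(mul_eq_zero.1 h3).resolve_left (by norm_num),
      (mul_eq_zero.1 h4).resolve_left (by norm_num)] at h1
    simp only [mul_zero, zero_add] at h1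
    rw [(mul_eq_zero.1 h1).resolve_left (mul_ne_zero hβ hβ), mul_zero] at h5
    exact h5.symm
  refine theta_zero θ fun κ => ?_
  rcases κ with q | k | ⟨k, b⟩ | u
  · exact hv q
  · exact hm k
  · exact ht k b
  · have h1 : ev (co0 p hp (bctr p)) θ = 0 := h (Sum.inr (Sum.inr (Sum.inr u)))
    exact (ev_co0 p hp _ _ (isPt_bctr p hp) θ).symm.trans (by rw [h1, mul_zero])

/-- The data map. -/
noncomputable def LL (p : Fin 3 → V2) (hp : AffineIndependent ℝ p) (nk : Fin 3 → V2) :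
    (JJ → ℝ) →ₗ[ℝ] (KK → ℝ) := LinearMap.pi fun κ => ev (rowR p hp nk κ)

lemma LL_inj (p : Fin 3 → V2) (hp : AffineIndependent ℝ p)
    (nk : Fin 3 → V2) (hnk : ∀ k, nk k ≠ 0 ∧ ⟪nk k, p (k + 2) - p (k + 1)⟫ = 0) :
    Function.Injective (LL p hp nk) := by
  rw [← LinearMap.ker_eq_bot, LinearMap.ker_eq_bot']
  intro θ h
  exact ker_zero p hp nk hnk θ fun κ => congrFun h κ

lemma LL_surj (p : Fin 3 → V2) (hp : AffineIndependent ℝ p)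
    (nk : Fin 3 → V2) (hnk : ∀ k, nk k ≠ 0 ∧ ⟪nk k, p (k + 2) - p (k + 1)⟫ = 0) :
    Function.Surjective (LL p hp nk) := by
  refine (LinearMap.injective_iff_surjective_of_finrank_eq_finrank ?_).1 (LL_inj p hp nk hnk)
  simp

/-- The data vector. -/
def tgt (fdat : Fin 3 → ℕ → ℕ → ℝ) (g : Fin 3 → ℝ) (gg : Fin 3 → Fin 3 → ℝ) (h0 : ℝ) : KK → ℝ
  | Sum.inl (k, a) =>
    (![fdat k 0 0, fdat k 1 0, fdat k 0 1, fdat k 2 0, fdat k 1 1, fdat k 0 2] : Fin 6 → ℝ) a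
  | Sum.inr (Sum.inl k) => g k
  | Sum.inr (Sum.inr (Sum.inl (k, b))) => gg k (li k b)
  | Sum.inr (Sum.inr (Sum.inr _)) => h0

lemma li_surj : ∀ k l : Fin 3, k ≠ l → ∃ b, li k b = l := by decide

lemma data_iff (p : Fin 3 → V2) (hp : AffineIndependent ℝ p) (nk : Fin 3 → V2)
    (fdat : Fin 3 → ℕ → ℕ → ℝ) (g : Fin 3 → ℝ) (gg : Fin 3 → Fin 3 → ℝ) (h0 : ℝ)
    (θ : JJ → ℝ) (s : V2 → ℝ) (h : Set.EqOn s (spn p hp θ) (tri p)) :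
    ((∀ k : Fin 3, ∀ α β : ℕ, α + β ≤ 2 →
        iteratedFDerivWithin ℝ (α + β) s (tri p) (p k)
          (fun j : Fin (α + β) => if (j : ℕ) < α then ee 0 else ee 1) = fdat k α β) ∧
      (∀ k : Fin 3,
        iteratedFDerivWithin ℝ 1 s (tri p) (qmid p k) (fun _ => nk k) = g k) ∧
      (∀ k l : Fin 3, k ≠ l →
        iteratedFDerivWithin ℝ 2 s (tri p) (ptrisect p k l) (fun _ => nk k) = gg k l) ∧
      s (bctr p) = h0) ↔ LL p hp nk θ = tgt fdat g gg h0 := by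
  have e00 : ∀ k, iteratedFDerivWithin ℝ (0 + 0) s (tri p) (p k)
      (fun j : Fin (0 + 0) => if (j : ℕ) < 0 then ee 0 else ee 1)
        = ev (vR p hp (p k) 0) θ := by
    intro k
    rw [vR0]
    exact it0 p hp θ s h (p k) (mem_vertex p hp k) _
  have e10 : ∀ k, iteratedFDerivWithin ℝ (1 + 0) s (tri p) (p k)
      (fun j : Fin (1 + 0) => if (j : ℕ) < 1 then ee 0 else ee 1)
        = ev (vR p hp (p k) 1) θ := by
    intro k
    rw [vR1]
    refine (it1 p hp θ s h (p k) (mem_vertex p hp k) _).trans ?_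
    simp
  have e01 : ∀ k, iteratedFDerivWithin ℝ (0 + 1) s (tri p) (p k)
      (fun j : Fin (0 + 1) => if (j : ℕ) < 0 then ee 0 else ee 1)
        = ev (vR p hp (p k) 2) θ := by
    intro k
    rw [vR2]
    refine (it1 p hp θ s h (p k) (mem_vertex p hp k) _).trans ?_
    simp
  have e20 : ∀ k, iteratedFDerivWithin ℝ (2 + 0) s (tri p) (p k)
      (fun j : Fin (2 + 0) => if (j : ℕ) < 2 then ee 0 else ee 1)
        = ev (vR p hp (p k) 3) θ := by
    intro k
    rw [vR3]
    refine (it2 p hp θ s h (p k) (mem_vertex p hp k) _).trans ?_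
    simp
  have e11 : ∀ k, iteratedFDerivWithin ℝ (1 + 1) s (tri p) (p k)
      (fun j : Fin (1 + 1) => if (j : ℕ) < 1 then ee 0 else ee 1)
        = ev (vR p hp (p k) 4) θ := by
    intro k
    rw [vR4]
    refine (it2 p hp θ s h (p k) (mem_vertex p hp k) _).trans ?_
    simp
  have e02 : ∀ k, iteratedFDerivWithin ℝ (0 + 2) s (tri p) (p k)
      (fun j : Fin (0 + 2) => if (j : ℕ) < 0 then ee 0 else ee 1)
        = ev (vR p hp (p k) 5) θ := by
    intro k
    rw [vR5]
    refine (it2 p hp θ s h (p k) (mem_vertex p hp k) _).trans ?_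
    simp
  have em := fun k => it1 p hp θ s h (qmid p k) (mem_mid p hp k) (fun _ => nk k)
  have et := fun k l hkl => it2 p hp θ s h (ptrisect p k l) (mem_tris p hp k l hkl) (fun _ => nk k)
  have eb : s (bctr p) = ev (co0 p hp (bctr p)) θ := by
    rw [h (interior_subset (bctr_mem p hp)), spn_eq]
  constructor
  · rintro ⟨hv, hm, ht, hb⟩
    funext κ
    rcases κ with ⟨k, a⟩ | k | ⟨k, b⟩ | u
    · fin_cases a
      · exact (e00 k).symm.trans (hv k 0 0 (by norm_num))
      · exact (e10 k).symm.trans (hv k 1 0 (by norm_num))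
      · exact (e01 k).symm.trans (hv k 0 1 (by norm_num))
      · exact (e20 k).symm.trans (hv k 2 0 (by norm_num))
      · exact (e11 k).symm.trans (hv k 1 1 (by norm_num))
      · exact (e02 k).symm.trans (hv k 0 2 (by norm_num))
    · exact (em k).symm.trans (hm k)
    · exact (et k _ (li_ne k b)).symm.trans (ht k _ (li_ne k b))
    · exact eb.symm.trans hb
  · intro H
    have H' : ∀ κ, ev (rowR p hp nk κ) θ = tgt fdat g gg h0 κ := fun κ => congrFun H κ
    refine ⟨fun k α β hab => ?_, fun k => ?_, fun k l hkl => ?_, ?_⟩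
    · have ha : α ≤ 2 := by omega
      have hb : β ≤ 2 := by omega
      interval_cases α <;> interval_cases β
      · exact (e00 k).trans (H' (Sum.inl (k, 0)))
      · exact (e01 k).trans (H' (Sum.inl (k, 2)))
      · exact (e02 k).trans (H' (Sum.inl (k, 5)))
      · exact (e10 k).trans (H' (Sum.inl (k, 1)))
      · exact (e11 k).trans (H' (Sum.inl (k, 4)))
      · omega
      · exact (e20 k).trans (H' (Sum.inl (k, 3)))
      · omega
      · omega
    · exact (em k).trans (H' (Sum.inr (Sum.inl k)))
    · obtain ⟨b, rfl⟩ := li_surj k l hkl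
      exact (et k _ (li_ne k b)).trans (H' (Sum.inr (Sum.inr (Sum.inl (k, b)))))
    · exact eb.trans (H' (Sum.inr (Sum.inr (Sum.inr ()))))

lemma spline_spn (p : Fin 3 → V2) (hp : AffineIndependent ℝ p) (s : V2 → ℝ)
    (hs : s ∈ splineSpace p) : ∃ θ, Set.EqOn s (spn p hp θ) (tri p) := by
  obtain ⟨d, c, h⟩ := spline_form p hp s hs.1 hs.2.1
  exact ⟨Sum.elim d c, fun z hz => h z hz⟩


/-- Hermite interpolation: given all partial derivatives up to order 2 at
the three vertices (18 values `fdat`), first normal derivatives at the edge midpoints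
and second normal derivatives at the six edge trisection points (9 values `g`, `gg`),
and the value at the barycenter (`h0`), there is a unique spline `s ∈ S₃²(Δ_{WS₃})`
matching these data.  Here `nk k` is a normal direction of the edge opposite `p k`,
and derivatives are taken within `Δ`. -/
theorem hermite_unisolvence (p : Fin 3 → V2) (hp : AffineIndependent ℝ p)
    (nk : Fin 3 → V2) (hnk : ∀ k, nk k ≠ 0 ∧ ⟪nk k, p (k + 2) - p (k + 1)⟫ = 0)
    (fdat : Fin 3 → ℕ → ℕ → ℝ) (g : Fin 3 → ℝ) (gg : Fin 3 → Fin 3 → ℝ) (h0 : ℝ) :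
    ∃! s : V2 → ℝ, s ∈ splineSpace p ∧
      (∀ k : Fin 3, ∀ α β : ℕ, α + β ≤ 2 →
        iteratedFDerivWithin ℝ (α + β) s (tri p) (p k)
          (fun j : Fin (α + β) => if (j : ℕ) < α then ee 0 else ee 1) = fdat k α β) ∧
      (∀ k : Fin 3,
        iteratedFDerivWithin ℝ 1 s (tri p) (qmid p k) (fun _ => nk k) = g k) ∧
      (∀ k l : Fin 3, k ≠ l →
        iteratedFDerivWithin ℝ 2 s (tri p) (ptrisect p k l) (fun _ => nk k) = gg k l) ∧
      s (bctr p) = h0 := by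
  have key := data_iff p hp nk fdat g gg h0
  obtain ⟨θ, hθ⟩ := LL_surj p hp nk hnk (tgt fdat g gg h0)
  have hE : Set.EqOn ((tri p).indicator (spn p hp θ)) (spn p hp θ) (tri p) :=
    fun z hz => Set.indicator_of_mem hz _
  refine ⟨(tri p).indicator (spn p hp θ), ⟨spl_mem p hp _ _, (key θ _ hE).2 hθ⟩, ?_⟩
  rintro s ⟨hs, hd⟩
  obtain ⟨θ', h'⟩ := spline_spn p hp s hs
  have e : θ' = θ := LL_inj p hp nk hnk (((key θ' s h').1 hd).trans hθ.symm)
  funext z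
  by_cases hz : z ∈ tri p
  · rw [h' hz, e, hE hz]
  · rw [hs.2.2 z hz, Set.indicator_of_notMem hz]
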